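/- arXiv:2407.21362 — 4 statements merged into one kernel-verified Lean document; each statement's English description precedes it below -/
import Mathlib

section
/- Let p be a prime, q = p^n, and D ⊆ 𝔽_q \ {0}. Suppose f : 𝔽_q → 𝔽_q satisfies (f(x) - f(y))/(x - y) ∈ D for all x ≠ y in 𝔽_q. If |D·D⁻¹·D⁻¹| ≤ (q+1)/2, then there exist a, b ∈ 𝔽_q and an integer 0 ≤ j ≤ n-1 such that f(x) = a·x^(p^j) + b for all x ∈ 𝔽_q. -/
open Pointwise

open Polynomial Finset

namespace FiniteField

variable {F : Type*} [Field F] [Fintype F]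

/-- The elementary symmetric polynomials of degree `1, …, q - 2` vanish on the elements of a field
with `q` elements, listed in any order. -/
theorem sum_powersetCard_prod_eq_zero {σ : F → F} (hσ : Function.Injective σ) {k : ℕ}
    (hk : 0 < k) (hkq : k + 2 ≤ Fintype.card F) :
    ∑ t ∈ powersetCard k (univ : Finset F), ∏ x ∈ t, σ x = 0 := by
  classical
  have hq := Fintype.one_lt_card (α := F)
  have hbij : Function.Bijective fun x => -σ x :=
    Finite.injective_iff_bijective.mp (neg_injective.comp hσ)
  have hprod : ∏ x : F, (X + C (σ x)) = (X ^ Fintype.card F - X : F[X]) := by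
    have h1 : ∏ x : F, (X - C x) = (X ^ Fintype.card F - X : F[X]) := by
      have h := prod_multiset_X_sub_C_of_monic_of_roots_card_eq
        (p := (X ^ Fintype.card F - X : F[X])) (monic_X_pow_sub (by simpa using hq))
        (by rw [roots_X_pow_card_sub_X, X_pow_card_sub_X_natDegree_eq F hq]; rfl)
      rwa [roots_X_pow_card_sub_X] at h
    rw [← h1, ← hbij.prod_comp fun x => (X - C x : F[X])]
    simp
  have h := Finset.prod_X_add_C_coeff (univ : Finset F) σ (k := Fintype.card F - k) (by simp)
  rw [hprod, card_univ, Nat.sub_sub_self (by omega)] at h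
  rw [← h, coeff_sub, coeff_X_pow, coeff_X, if_neg (by omega), if_neg (by omega), sub_zero]

/-- The elementary symmetric polynomials of the negatives of all elements but `x` are powers
of `x`. -/
theorem sum_powersetCard_erase_prod_neg [DecidableEq F] (x : F) {k : ℕ}
    (hkq : k + 2 ≤ Fintype.card F) :
    ∑ t ∈ powersetCard k (univ.erase x), ∏ y ∈ t, (-y) = x ^ k := by
  induction k with
  | zero => simp
  | succ k ih =>
    have h := sum_powersetCard_prod_eq_zero (F := F) neg_injective k.succ_pos hkq
    rw [← insert_erase (mem_univ x), powersetCard_succ_insert (notMem_erase x _),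
      sum_union, sum_image] at h
    · have h' : ∑ t ∈ powersetCard k (univ.erase x), ∏ y ∈ insert x t, (-y) = -x * x ^ k := by
        rw [← ih (by omega), mul_sum]
        refine sum_congr rfl fun t ht => ?_
        rw [prod_insert fun hx => notMem_erase x _ ((mem_powersetCard.mp ht).1 hx)]
      rw [h'] at h
      rw [pow_succ]
      linear_combination h
    · intro s hs t ht hst
      have hs' : x ∉ s := fun hx => notMem_erase x _ ((mem_powersetCard.mp hs).1 hx)
      have ht' : x ∉ t := fun hx => notMem_erase x _ ((mem_powersetCard.mp ht).1 hx)
      rw [← erase_insert hs', ← erase_insert ht', hst]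
    · rw [disjoint_left]
      intro t ht ht'
      obtain ⟨s, -, rfl⟩ := mem_image.mp ht'
      exact notMem_erase x _ ((mem_powersetCard.mp ht).1 (mem_insert_self x s))

/-- A sum over `k + 1`-subsets with a distinguished element, organised by that element. -/
theorem sum_powersetCard_succ_sum_erase {α M : Type*} [Fintype α] [DecidableEq α]
    [AddCommMonoid M] (k : ℕ) (φ : α → Finset α → M) :
    ∑ t ∈ powersetCard (k + 1) (univ : Finset α), ∑ x ∈ t, φ x (t.erase x) =
      ∑ x, ∑ s ∈ powersetCard k (univ.erase x), φ x s := by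
  rw [sum_sigma', sum_sigma']
  refine sum_bij' (fun a _ => ⟨a.2, a.1.erase a.2⟩) (fun a _ => ⟨insert a.1 a.2, a.1⟩)
    ?_ ?_ ?_ ?_ ?_
  · rintro ⟨t, x⟩ h
    simp only [mem_sigma, mem_powersetCard, mem_univ, true_and] at h ⊢
    exact ⟨erase_subset_erase _ (subset_univ _), by rw [card_erase_of_mem h.2, h.1.2]; rfl⟩
  · rintro ⟨x, s⟩ h
    simp only [mem_sigma, mem_powersetCard, mem_univ, true_and] at h ⊢
    have hx : x ∉ s := fun hx => notMem_erase x _ (h.1 hx)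
    exact ⟨⟨subset_univ _, by rw [card_insert_of_notMem hx, h.2]⟩, mem_insert_self _ _⟩
  · rintro ⟨t, x⟩ h
    simp only [mem_sigma] at h
    simp [insert_erase h.2]
  · rintro ⟨x, s⟩ h
    simp only [mem_sigma, mem_powersetCard] at h
    have hx : x ∉ s := fun hx => notMem_erase x _ (h.2.1 hx)
    simp [erase_insert hx]
  · intros
    rfl

/-- If the difference quotients of `f` lie in a set `E` of nonzero elements, then
the moments `∑ x ^ k * f x` vanish for `k` less than the number of elements outside `E`. -/
theorem sum_pow_mul_eq_zero_of_slope_mem {E : Set F} (hE : (0 : F) ∉ E) {f : F → F}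
    (hf : ∀ x y, x ≠ y → (f x - f y) / (x - y) ∈ E) {k : ℕ} (hk : k < Eᶜ.ncard)
    (hkq : k + 3 ≤ Fintype.card F) : ∑ x, x ^ k * f x = 0 := by
  classical
  set c : F[X] := ∑ t ∈ powersetCard (k + 1) (univ : Finset F), ∏ x ∈ t, (C (f x) * X - C x)
    with hc
  have hdeg1 (x : F) : (C (f x) * X - C x).natDegree ≤ 1 := by
    rw [sub_eq_add_neg, ← C_neg]
    exact natDegree_linear_le
  have hdeg : c.natDegree ≤ k + 1 := by
    refine natDegree_sum_le_of_forall_le _ _ fun t ht => (natDegree_prod_le _ _).trans ?_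
    refine (sum_le_sum fun x _ => hdeg1 x).trans ?_
    simp [(mem_powersetCard.mp ht).2]
  have htop : c.coeff (k + 1) = 0 := by
    have hinj : Function.Injective f := by
      intro x y hxy
      by_contra hne
      exact hE (by simpa [hxy] using hf x y hne)
    rw [hc, finsetSum_coeff, ← sum_powersetCard_prod_eq_zero hinj k.succ_pos (by omega)]
    refine sum_congr rfl fun t ht => ?_
    have h := coeff_prod_of_natDegree_le (s := t) (fun x => C (f x) * X - C x) 1
      fun x _ => hdeg1 x
    rw [(mem_powersetCard.mp ht).2, mul_one] at h
    rw [h]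
    exact prod_congr rfl fun x _ => by simp [coeff_C]
  have hlt : c.natDegree < k + 1 := by
    refine lt_of_le_of_ne hdeg fun h => ?_
    rw [← h, coeff_natDegree, leadingCoeff_eq_zero] at htop
    simp [htop] at h
  have hroot : ∀ m ∈ Eᶜ, c.eval m⁻¹ = 0 := by
    intro m hm
    have hinj : Function.Injective fun x => f x * m⁻¹ - x := by
      intro x y hxy
      by_contra hne
      have hxy0 : x - y ≠ 0 := sub_ne_zero.mpr hne
      have hxy' : (f x - f y) * m⁻¹ = x - y := by
        simp only at hxy
        linear_combination hxy
      have hm0 : m ≠ 0 := by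
        rintro rfl
        exact hxy0 (by rw [← hxy']; simp)
      apply hm
      convert hf x y hne using 1
      rw [← hxy']
      have : f x - f y ≠ 0 := fun h0 => hxy0 (by rw [← hxy', h0, zero_mul])
      field_simp
    rw [hc, eval_finsetSum, ← sum_powersetCard_prod_eq_zero hinj k.succ_pos (by omega)]
    exact sum_congr rfl fun t _ => by simp [eval_prod]
  have hc0 : c = 0 := by
    refine eq_zero_of_natDegree_lt_card_of_eval_eq_zero' c (Eᶜ.toFinset.image (·⁻¹)) ?_ ?_
    · intro z hz
      obtain ⟨m, hm, rfl⟩ := mem_image.mp hz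
      exact hroot m (Set.mem_toFinset.mp hm)
    · rw [card_image_of_injective _ inv_injective, ← Set.ncard_eq_toFinset_card']
      omega
  have hder : (derivative c).eval 0 = ∑ x, x ^ k * f x := by
    calc (derivative c).eval 0
        = ∑ t ∈ powersetCard (k + 1) (univ : Finset F), ∑ x ∈ t,
            (∏ y ∈ t.erase x, (-y)) * f x := by
          simp [hc, derivative_prod_finset, eval_finsetSum, eval_prod]
      _ = ∑ x, x ^ k * f x := by
          rw [sum_powersetCard_succ_sum_erase k fun x s => (∏ y ∈ s, (-y)) * f x]
          refine sum_congr rfl fun x _ => ?_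
          rw [← sum_mul, sum_powersetCard_erase_prod_neg x (by omega)]
  rw [← hder, hc0]
  simp

theorem sum_pow_card_sub_one : ∑ x : F, x ^ (Fintype.card F - 1) = -1 := by
  classical
  have hq := Fintype.one_lt_card (α := F)
  rw [← add_sum_erase _ _ (mem_univ 0), zero_pow (by omega), zero_add,
    sum_congr rfl fun x hx => pow_card_sub_one_eq_one x (ne_of_mem_erase hx)]
  simp [card_erase_of_mem, Nat.cast_sub hq.le]

/-- The top coefficient of a reduced polynomial as a moment of its values. -/
theorem sum_pow_mul_eval (P : F[X]) (hP : P.natDegree < Fintype.card F) :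
    ∑ x, x ^ (Fintype.card F - 1 - P.natDegree) * P.eval x = -P.leadingCoeff := by
  simp_rw [eval_eq_sum_range, mul_sum]
  rw [sum_comm, sum_range_succ, sum_eq_zero, zero_add]
  · rw [← mul_neg_one, ← sum_pow_card_sub_one, mul_sum, leadingCoeff]
    refine sum_congr rfl fun x _ => ?_
    rw [mul_left_comm, ← pow_add]
    congr 2
    omega
  · intro i hi
    rw [mem_range] at hi
    have h := sum_pow_lt_card_sub_one F (Fintype.card F - 1 - P.natDegree + i) (by omega)
    rw [← mul_zero (P.coeff i), ← h, mul_sum]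
    exact sum_congr rfl fun x _ => by rw [pow_add]; ring

/-- A function on a field with `q` elements whose difference quotients are nonzero and take at
most `(q + 1) / 2` values is a polynomial of degree at most `q / 2`. -/
theorem exists_polynomial_of_slope_mem {E : Set F} (hE : (0 : F) ∉ E)
    (hcard : E.ncard ≤ (Fintype.card F + 1) / 2) {f : F → F}
    (hf : ∀ x y, x ≠ y → (f x - f y) / (x - y) ∈ E) :
    ∃ P : F[X], 2 * P.natDegree ≤ Fintype.card F ∧ ∀ x, P.eval x = f x := by
  classical
  have hq := Fintype.one_lt_card (α := F)
  set P := Lagrange.interpolate univ id f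
  have heval (x : F) : P.eval x = f x :=
    Lagrange.eval_interpolate_at_node f Function.injective_id.injOn (mem_univ x)
  have hdeg : P.natDegree < Fintype.card F := by
    by_cases h0 : P = 0
    · simp [h0]; omega
    · rw [natDegree_lt_iff_degree_lt h0]
      exact Lagrange.degree_interpolate_lt f Function.injective_id.injOn
  refine ⟨P, ?_, heval⟩
  by_contra! hlt
  have hcompl := Set.ncard_add_ncard_compl E
  rw [Nat.card_eq_fintype_card] at hcompl
  have h := sum_pow_mul_eval P hdeg
  simp_rw [heval] at h
  rw [sum_pow_mul_eq_zero_of_slope_mem hE hf (by omega) (by omega), eq_comm, neg_eq_zero,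
    leadingCoeff_eq_zero] at h
  simp [h] at hlt

/-- If `P` and `G` have small degrees and `P x * G x⁻¹ = 1` on nonzero elements, then `P` is a
monomial. -/
theorem exists_eq_C_mul_X_pow_of_eval_mul_eval_inv {P G : F[X]}
    (hdeg : P.natDegree + G.natDegree ≤ Fintype.card F) (hP : P.eval 0 = 0) (hG : G.eval 0 = 0)
    (h : ∀ x, x ≠ 0 → P.eval x * G.eval x⁻¹ = 1) :
    ∃ a : F, a ≠ 0 ∧ P = C a * X ^ P.natDegree := by
  have hG0 : G ≠ 0 := by
    rintro rfl
    simpa using h 1 one_ne_zero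
  have hGt : G.natTrailingDegree ≠ 0 := by
    rw [Ne, natTrailingDegree_eq_zero, not_or, not_not, coeff_zero_eq_eval_zero]
    exact ⟨hG0, hG⟩
  have hle := natTrailingDegree_le_natDegree G
  have heq : P * G.reverse = X ^ G.natDegree := by
    have hq := Fintype.card_pos (α := F)
    have hP0 : P ≠ 0 := by
      rintro rfl
      simpa using h 1 one_ne_zero
    have hPd : 0 < P.natDegree := by
      refine Nat.pos_of_ne_zero fun h0 => hP0 ?_
      rw [eq_C_of_natDegree_eq_zero h0] at hP ⊢
      simpa using hP
    refine eq_of_natDegree_lt_card_of_eval_eq' _ _ (univ : Finset F) ?_ ?_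
    · intro x _
      by_cases hx : x = 0
      · subst hx
        rw [eval_mul, hP, zero_mul, eval_pow, eval_X, zero_pow (by omega)]
      · have hx' : x⁻¹ ≠ 0 := inv_ne_zero hx
        let := invertibleOfNonzero hx'
        have hr := eval₂_reverse_mul_pow (RingHom.id F) x⁻¹ G
        rw [invOf_eq_inv, inv_inv, ← eval, ← eval] at hr
        rw [eval_mul, eval_pow, eval_X]
        calc P.eval x * G.reverse.eval x
            = P.eval x * (G.reverse.eval x * x⁻¹ ^ G.natDegree) * x ^ G.natDegree := by
              rw [mul_assoc, mul_assoc, ← mul_pow, inv_mul_cancel₀ hx, one_pow, mul_one]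
          _ = x ^ G.natDegree := by rw [hr, h x hx, one_mul]
    · rw [card_univ, max_lt_iff, natDegree_X_pow]
      have h1 := natDegree_mul_le (p := P) (q := G.reverse)
      rw [reverse_natDegree] at h1
      constructor <;> omega
  obtain ⟨i, -, u, hu⟩ := (dvd_prime_pow prime_X _).mp (Dvd.intro _ heq)
  obtain ⟨a, ha, hau⟩ := Polynomial.isUnit_iff.mp (u⁻¹).isUnit
  have hPX : P = C a * X ^ i := by
    rw [hau, ← hu, mul_comm, mul_assoc, Units.mul_inv, mul_one]
  refine ⟨a, ha.ne_zero, ?_⟩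
  conv_rhs => rw [hPX, natDegree_C_mul_X_pow i a ha.ne_zero]
  exact hPX

/-- If `(X + 1) ^ d - 1` is a monomial in characteristic `p`, then `d` is a power of `p`. -/
theorem exists_eq_prime_pow_of_add_one_pow {K : Type*} [Field K] {p : ℕ} [Fact p.Prime]
    [CharP K p] {d e : ℕ} (hd : d ≠ 0) {a : K}
    (h : (1 + X : K[X]) ^ d - 1 = C a * X ^ e) : ∃ j, d = p ^ j := by
  have hp := Fact.out (p := p.Prime)
  have hcoeff (i : ℕ) (hi : i ≠ 0) (hi' : (d.choose i : K) ≠ 0) : i = e := by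
    by_contra hne
    have := congrArg (coeff · i) h
    simp only [coeff_sub, coeff_one_add_X_pow, coeff_C_mul_X_pow, if_neg hne, coeff_one,
      if_neg hi, sub_zero] at this
    exact hi' this
  obtain ⟨j, m, hm, rfl⟩ := Nat.exists_eq_pow_mul_and_not_dvd hd p hp.ne_one
  refine ⟨j, ?_⟩
  have hpj : p ^ j ≠ 0 := pow_ne_zero _ hp.ne_zero
  have hchoose : ((p ^ j * m).choose (p ^ j) : K) = m := by
    have h1 : (1 + X : K[X]) ^ (p ^ j * m) = expand K (p ^ j) ((1 + X) ^ m) := by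
      rw [pow_mul, add_pow_char_pow]
      simp
    have h2 := congrArg (coeff · (p ^ j)) h1
    have h3 := coeff_expand_mul (Nat.pos_of_ne_zero hpj) ((1 + X : K[X]) ^ m) 1
    rw [one_mul] at h3
    simp only [h3, coeff_one_add_X_pow, Nat.choose_one_right] at h2
    exact h2
  have h1 := hcoeff (p ^ j) hpj (by rwa [hchoose, Ne, CharP.cast_eq_zero_iff K p])
  have h2 := hcoeff (p ^ j * m) hd (by simp)
  exact h2.trans h1.symm

/-- A function vanishing at `0` whose difference quotients lie in a set `D` of nonzero elements
with `|D D⁻¹ D⁻¹| ≤ (q + 1) / 2` is a monomial of degree at most `q / 2`. -/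
theorem exists_monomial_of_slope_mem {D : Set F} (hD : D ⊆ {0}ᶜ)
    (hcard : (D * D⁻¹ * D⁻¹).ncard ≤ (Fintype.card F + 1) / 2) {f : F → F} (hf0 : f 0 = 0)
    (hf : ∀ x y, x ≠ y → (f x - f y) / (x - y) ∈ D) :
    ∃ a : F, a ≠ 0 ∧ ∃ d, d ≠ 0 ∧ 2 * d ≤ Fintype.card F ∧ ∀ x, f x = a * x ^ d := by
  have hD0 : ∀ d ∈ D, d ≠ 0 := fun d hd => hD hd
  have hfx (x : F) (hx : x ≠ 0) : f x / x ∈ D := by simpa [hf0] using hf x 0 hx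
  have hfne (x : F) (hx : x ≠ 0) : f x ≠ 0 := fun h => hD0 _ (hfx x hx) (by simp [h])
  have hDcard : D.ncard ≤ (Fintype.card F + 1) / 2 := by
    have h1 := hfx 1 one_ne_zero
    set c := f 1 / 1
    have hc := hD0 c h1
    refine le_trans (Set.ncard_le_ncard_of_injOn (fun d => d * c⁻¹ * c⁻¹) ?_ ?_ (Set.toFinite _))
      hcard
    · intro d hd
      exact Set.mul_mem_mul (Set.mul_mem_mul hd (Set.inv_mem_inv.mpr h1)) (Set.inv_mem_inv.mpr h1)
    · intro x _ y _ hxy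
      simpa [hc] using hxy
  obtain ⟨P, hPdeg, hP⟩ := exists_polynomial_of_slope_mem (fun h => hD0 0 h rfl) hDcard hf
  obtain ⟨G, hGdeg, hG⟩ := exists_polynomial_of_slope_mem (E := D * D⁻¹ * D⁻¹)
    (f := fun x => (f x⁻¹)⁻¹) (by
      rintro ⟨_, ⟨a, ha, b, hb, rfl⟩, c, hc, h⟩
      have hb' := hD0 _ hb
      have hc' := hD0 _ hc
      have ha' := hD0 _ ha
      rw [Ne, inv_eq_zero] at hb' hc'
      exact mul_ne_zero (mul_ne_zero ha' hb') hc' h) hcard (by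
      have hmem : ∀ x, x ≠ 0 → (f x⁻¹)⁻¹ / x ∈ D⁻¹ := by
        intro x hx
        rw [Set.mem_inv]
        convert hfx x⁻¹ (inv_ne_zero hx) using 1
        simp [div_eq_mul_inv, mul_comm]
      have hsingle : ∀ x, x ≠ 0 → (f x⁻¹)⁻¹ / x ∈ D * D⁻¹ * D⁻¹ := by
        intro x hx
        have h1 := hfx 1 one_ne_zero
        refine ⟨1, ⟨f 1 / 1, h1, _, Set.inv_mem_inv.mpr h1, ?_⟩, _, hmem x hx, one_mul _⟩
        exact mul_inv_cancel₀ (hD0 _ h1)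
      intro x y hxy
      by_cases hx : x = 0
      · subst hx
        simpa [hf0, neg_div_neg_eq] using hsingle y (Ne.symm hxy)
      by_cases hy : y = 0
      · subst hy
        simpa [hf0] using hsingle x hx
      refine ⟨_, ⟨_, hf x⁻¹ y⁻¹ (inv_injective.ne hxy), _, hmem x hx, rfl⟩, _, hmem y hy, ?_⟩
      have h1 := hfne _ (inv_ne_zero hx)
      have h2 := hfne _ (inv_ne_zero hy)
      have h3 : x - y ≠ 0 := sub_ne_zero.mpr hxy
      have h4 : x⁻¹ - y⁻¹ = -(x - y) / (x * y) := by field_simp; ring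
      simp only [h4]
      generalize f x⁻¹ = u at h1 ⊢
      generalize f y⁻¹ = v at h2 ⊢
      field_simp
      ring)
  obtain ⟨a, ha, hPa⟩ := exists_eq_C_mul_X_pow_of_eval_mul_eval_inv (P := P) (G := G) (by omega)
    (by rw [hP, hf0]) (by rw [hG]; simp [hf0])
    (fun x hx => by rw [hP, hG, inv_inv, mul_inv_cancel₀ (hfne x hx)])
  have hform (x : F) : f x = a * x ^ P.natDegree := by
    rw [← hP, hPa]
    simp [ha]
  refine ⟨a, ha, P.natDegree, fun h => ?_, hPdeg, hform⟩
  have := hform 0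
  rw [hf0, h, pow_zero, mul_one] at this
  exact ha this.symm

end FiniteField

theorem stmt_0 {p n : ℕ} (hp : p.Prime) (hn : 0 < n)
    {F : Type*} [Field F] [Fintype F] (hF : Fintype.card F = p ^ n)
    (D : Set F) (hD : D ⊆ {0}ᶜ)
    (f : F → F) (hf : ∀ x y : F, x ≠ y → (f x - f y) / (x - y) ∈ D)
    (hcard : (D * D⁻¹ * D⁻¹).ncard ≤ (p ^ n + 1) / 2) :
    ∃ a b : F, ∃ j : ℕ, j ≤ n - 1 ∧ ∀ x : F, f x = a * x ^ (p ^ j) + b := by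
  have : Fact p.Prime := ⟨hp⟩
  have : CharP F p := charP_of_card_eq_prime_pow hF
  rw [← hF] at hcard
  obtain ⟨a, ha, d, hd, hdq, had⟩ := FiniteField.exists_monomial_of_slope_mem hD hcard
    (f := fun x => f x - f 0) (sub_self _) (fun x y hxy => by simpa using hf x y hxy)
  obtain ⟨b, -, e, -, heq, hbe⟩ := FiniteField.exists_monomial_of_slope_mem hD hcard
    (f := fun x => f (1 + x) - f 1) (by simp)
    (fun x y hxy => by simpa using hf (1 + x) (1 + y) (by simpa using hxy))
  have hq := Fintype.card_pos (α := F)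
  have hpoly : (1 + X : F[X]) ^ d - 1 = C (a⁻¹ * b) * X ^ e := by
    refine eq_of_natDegree_lt_card_of_eval_eq' _ _ (univ : Finset F) (fun x _ => ?_) ?_
    · have h1 := had (1 + x)
      have h2 := had 1
      have h3 := hbe x
      simp only [eval_sub, eval_pow, eval_add, eval_one, eval_X, eval_mul, eval_C]
      rw [mul_assoc, ← h3]
      field_simp
      rw [one_pow] at h2
      linear_combination h2 - h1
    · rw [card_univ, max_lt_iff]
      constructor
      · refine lt_of_le_of_lt (b := d) ?_ (by omega)
        compute_degree
      · exact (natDegree_C_mul_X_pow_le _ _).trans_lt (by omega)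
  obtain ⟨j, rfl⟩ := FiniteField.exists_eq_prime_pow_of_add_one_pow (p := p) hd hpoly
  refine ⟨a, f 0, j, ?_, fun x => by rw [← had x, sub_add_cancel]⟩
  have : p ^ j < p ^ n := by omega
  have := (Nat.pow_lt_pow_iff_right hp.one_lt).mp this
  omega
end

section
/- Let p be a prime, q = p^n, and D ⊆ 𝔽_q \ {0}. Suppose f : 𝔽_q → 𝔽_q satisfies (f(x)-f(y))/(x-y) ∈ D for all x ≠ y. If c > 0 is a real number with |DD| ≤ c|D| and c³|D| ≤ (q+1)/2, then there exist a, b ∈ 𝔽_q and 0 ≤ j ≤ n-1 such that f(x) = a·x^(p^j) + b for all x. -/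
open Pointwise

open Polynomial Finset in
/-- For a permutation of a finite field with `q` elements, the elementary symmetric functions of
degrees `q - m` with `1 < m < q` vanish. -/
lemma sum_powersetCard_prod_eq_zero_of_injective {F : Type*} [Field F] [Fintype F]
    {r : F → F} (hr : Function.Injective r) {m : ℕ} (hm : 1 < m) (hmq : m < Fintype.card F) :
    ∑ t ∈ powersetCard (Fintype.card F - m) (univ : Finset F), ∏ i ∈ t, r i = 0 := by
  have hprod : ∏ i : F, (X + C (r i)) = (X ^ Fintype.card F - X : F[X]) := by
    have hmonic : (X ^ Fintype.card F - X : F[X]).Monic :=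
      monic_X_pow_sub (by simpa using Fintype.one_lt_card)
    have hroots := prod_multiset_X_sub_C_of_monic_of_roots_card_eq hmonic (by
      rw [FiniteField.roots_X_pow_card_sub_X,
        FiniteField.X_pow_card_sub_X_natDegree_eq F Fintype.one_lt_card]
      rfl)
    rw [FiniteField.roots_X_pow_card_sub_X] at hroots
    rw [← hroots]
    change _ = ∏ a : F, (X - C a)
    have hb : Function.Bijective fun i => -r i :=
      Finite.injective_iff_bijective.mp (neg_injective.comp hr)
    rw [← hb.prod_comp (fun a => (X - C a : F[X]))]
    simp
  rw [← Finset.card_univ, ← Finset.prod_X_add_C_coeff univ r (by simpa using hmq.le), hprod]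
  simp [coeff_X_pow, coeff_X, hm.ne, hmq.ne]

open Polynomial Finset in
/-- A function on a finite field whose slopes all lie in a set `D` of nonzero elements is
interpolated by a polynomial of degree less than `|D|` (or less than `2`). -/
lemma exists_natDegree_lt_of_slopes_mem {F : Type*} [Field F] [Fintype F]
    {D : Finset F} (hD : 0 ∉ D) {f : F → F}
    (hf : ∀ x y : F, x ≠ y → (f x - f y) / (x - y) ∈ D) :
    ∃ P : F[X], P.natDegree < max 2 #D ∧ ∀ x, P.eval x = f x := by
  classical
  set N := max 2 #D
  set q := Fintype.card F with hq
  have hfinj : Function.Injective f := by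
    intro x y hxy
    by_contra hne
    exact hD (by simpa [hxy] using hf x y hne)
  let r : F → F[X] := fun i => C i - C (f i) * X
  have hrdeg (i : F) : (r i).natDegree ≤ 1 := by
    simp only [r]; compute_degree
  set R : F[X][X] := ∏ i : F, (X + C (r i)) with hR
  have hRdeg : R.natDegree = q := by
    rw [hR, natDegree_prod_of_monic _ _ fun i _ => monic_X_add_C (r i)]
    simp [hq]
  have hcoeff {m : ℕ} (hm : m ≤ q) :
      R.coeff m = ∑ t ∈ powersetCard (q - m) (univ : Finset F), ∏ i ∈ t, r i := by
    rw [hR, Finset.prod_X_add_C_coeff univ r (by simpa using hm), Finset.card_univ]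
  have hvanish {m : ℕ} (hm : N ≤ m) (hmq : m < q) : R.coeff m = 0 := by
    have hm2 : 1 < m := lt_of_lt_of_le one_lt_two ((le_max_left _ _).trans hm)
    have htop : (R.coeff m).coeff (q - m) = 0 := by
      rw [hcoeff hmq.le, finsetSum_coeff,
        ← sum_powersetCard_prod_eq_zero_of_injective (neg_injective.comp hfinj) hm2 hmq]
      refine sum_congr rfl fun t ht => ?_
      have := coeff_prod_of_natDegree_le (s := t) r 1 fun i _ => hrdeg i
      rw [mul_one, (mem_powersetCard.mp ht).2] at this
      rw [this]
      simp [r]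
    have hle : (R.coeff m).natDegree ≤ q - m := by
      rw [hcoeff hmq.le]
      refine natDegree_sum_le_of_forall_le _ _ fun t ht => ?_
      refine (natDegree_prod_le _ _).trans ?_
      refine (sum_le_sum fun i _ => hrdeg i).trans ?_
      simp [(mem_powersetCard.mp ht).2]
    have hlt : (R.coeff m).natDegree < q - m := by
      refine lt_of_le_of_ne hle fun h => ?_
      rw [← h, coeff_natDegree, leadingCoeff_eq_zero] at htop
      rw [htop, natDegree_zero] at h
      omega
    have hcard : #((Dᶜ).image fun y => y⁻¹) = q - #D := by
      rw [card_image_of_injective _ inv_injective, card_compl]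
    refine eq_zero_of_natDegree_lt_card_of_eval_eq_zero' _ ((Dᶜ).image fun y => y⁻¹) ?_ ?_
    · intro z hz
      obtain ⟨y, hy, rfl⟩ := mem_image.mp hz
      rw [hcoeff hmq.le, eval_finsetSum]
      have hinj : Function.Injective fun i => i - f i * y⁻¹ := by
        intro i k hik
        by_contra hne
        have hne' : i - k ≠ 0 := sub_ne_zero.mpr hne
        have h1 : (f i - f k) * y⁻¹ = i - k := by
          simp only at hik
          linear_combination -hik
        have h2 : (f i - f k) / (i - k) = y := by
          have hy0 : y ≠ 0 := by
            rintro rfl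
            exact hne' (by simpa using h1.symm)
          rw [div_eq_iff hne', ← h1]
          field_simp
        exact (mem_compl.mp hy) (h2 ▸ hf i k hne)
      rw [← sum_powersetCard_prod_eq_zero_of_injective hinj hm2 hmq]
      refine sum_congr rfl fun t _ => ?_
      simp [r, eval_prod]
    · rw [hcard]
      have := le_max_right 2 #D
      omega
  let P : F[X] := ∑ m ∈ range N, C ((R.coeff m).coeff 1) * X ^ m
  have hRq : R.coeff q = 1 := by
    rw [hcoeff le_rfl]; simp
  have hκ (v : F) : ∏ i ∈ univ.erase v, (i - v) = -1 := by
    have : ∏ i ∈ univ.erase v, (i - v) = ∏ u : Fˣ, (u : F) := by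
      symm
      refine prod_bij (fun u _ => (u : F) + v) ?_ ?_ ?_ ?_
      · simp
      · intro a _ b _ h
        exact Units.ext (add_right_cancel h)
      · intro b hb
        exact ⟨Units.mk0 (b - v) (sub_ne_zero.mpr (mem_erase.mp hb).1), mem_univ _, by simp⟩
      · simp
    rw [this, ← Units.coe_prod, FiniteField.prod_univ_units_id_eq_neg_one]
    simp
  have hP (v : F) : P.eval (-v) = f v := by
    have h1 : (R.eval (C (-v))).coeff 1 = f v := by
      rw [hR, eval_prod, ← mul_prod_erase univ _ (mem_univ v)]
      have : eval (C (-v)) (X + C (r v)) = X * C (-f v) := by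
        simp [r]; ring
      rw [this, mul_assoc, coeff_X_mul, coeff_C_mul, coeff_zero_eq_eval_zero, eval_prod]
      have : ∀ i, eval 0 (eval (C (-v)) (X + C (r i))) = i - v := by
        intro i; simp [r]; ring
      simp only [this, hκ]
      ring
    rw [← h1, eval_eq_sum_range (p := R), hRdeg, finsetSum_coeff, sum_range_succ, hRq]
    have hterm (m : ℕ) : (R.coeff m * C (-v) ^ m).coeff 1 = (R.coeff m).coeff 1 * (-v) ^ m := by
      rw [← C_pow, coeff_mul_C]
    have hlast : ((1 : F[X]) * C (-v) ^ q).coeff 1 = 0 := by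
      rw [one_mul, ← C_pow, coeff_C]; simp
    rw [hlast, add_zero]
    simp only [hterm, P, eval_finsetSum, eval_mul, eval_C, eval_pow, eval_X]
    rcases le_total N q with h | h
    · refine sum_subset (range_mono h) fun m hm hm' => ?_
      rw [hvanish (by simpa using hm') (by simpa using hm)]
      simp
    · symm
      refine sum_subset (range_mono h) fun m hm hm' => ?_
      rcases eq_or_lt_of_le (show q ≤ m by simpa using hm') with rfl | h'
      · rw [hRq]; simp [coeff_one]
      · rw [coeff_eq_zero_of_natDegree_lt (p := R) (hRdeg.trans_lt h')]; simp
  refine ⟨P.comp (-X), ?_, fun x => ?_⟩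
  · have hPdeg : P.natDegree < N := by
      refine (natDegree_sum_le_of_forall_le _ _ fun m hm => ?_).trans_lt
        (show N - 1 < N by omega)
      refine (natDegree_C_mul_X_pow_le _ _).trans ?_
      have := mem_range.mp hm
      omega
    simpa [natDegree_comp] using hPdeg
  · rw [eval_comp, ← hP x]; simp

open Polynomial Finset in
/-- If `f` and `x ↦ 1 / f (1 / x)` both have degree at most `q / 2` over a field with `q` elements,
and `f` vanishes only at `0`, then `f` is a monomial. -/
lemma exists_eq_mul_pow_of_natDegree_le {F : Type*} [Field F] [Fintype F] {f : F → F}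
    (hf : ∀ x, f x = 0 ↔ x = 0) {P Q : F[X]} (hP : 2 * P.natDegree ≤ Fintype.card F)
    (hQ : 2 * Q.natDegree ≤ Fintype.card F) (hPf : ∀ x, P.eval x = f x)
    (hQf : ∀ x, Q.eval x = (f x⁻¹)⁻¹) :
    ∃ (a : F) (k : ℕ), a ≠ 0 ∧ 2 * k ≤ Fintype.card F ∧ ∀ x, f x = a * x ^ k := by
  have hP0 : P.coeff 0 = 0 := by
    rw [coeff_zero_eq_eval_zero, hPf, hf]
  have hPne : P ≠ 0 := by
    rintro rfl
    exact one_ne_zero ((hf 1).mp (by simpa using (hPf 1).symm))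
  have hdpos : 0 < P.natDegree := by
    rw [pos_iff_ne_zero]
    intro h
    exact hPne (by rw [eq_C_of_natDegree_eq_zero h, hP0, C_0])
  have htrail : 0 < P.natTrailingDegree :=
    Nat.pos_of_ne_zero fun h => by
      rcases natTrailingDegree_eq_zero.mp h with h | h
      exacts [hPne h, h hP0]
  have hq := Fintype.one_lt_card (α := F)
  have hmul : P.reverse * Q = X ^ P.natDegree := by
    rw [← sub_eq_zero]
    refine eq_zero_of_natDegree_lt_card_of_eval_eq_zero' _ univ (fun x _ => ?_) ?_
    · rcases eq_or_ne x 0 with rfl | hx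
      · simp [hQf, (hf 0).mpr rfl, hdpos.ne']
      · have hfx : f x⁻¹ ≠ 0 := by simpa [hf] using hx
        let _ : Invertible x⁻¹ := invertibleOfNonzero (inv_ne_zero hx)
        have h := eval₂_reverse_mul_pow (RingHom.id F) x⁻¹ P
        rw [invOf_eq_inv, inv_inv] at h
        change eval x P.reverse * _ = eval x⁻¹ P at h
        rw [eval_sub, eval_mul, eval_pow, eval_X, hQf, ← hPf x⁻¹, sub_eq_zero,
          mul_inv_eq_iff_eq_mul₀ (by rwa [hPf]), ← h, inv_pow]
        field_simp
    · refine (natDegree_sub_le _ _).trans_lt (max_lt ?_ ?_)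
      · refine natDegree_mul_le.trans_lt ?_
        rw [reverse_natDegree, card_univ]
        omega
      · rw [natDegree_X_pow, card_univ]
        omega
  obtain ⟨i, hi, hassoc⟩ := (dvd_prime_pow prime_X _).mp (Dvd.intro_left _ hmul)
  obtain ⟨u, hu⟩ := hassoc.symm
  obtain ⟨a, ha, hau⟩ := Polynomial.isUnit_iff.mp u.isUnit
  refine ⟨a⁻¹, i, inv_ne_zero ha.ne_zero, by omega, fun x => ?_⟩
  have h := hQf x⁻¹
  rw [← hu, ← hau, inv_inv] at h
  rw [← inv_inv (f x), ← h, eval_mul, eval_pow, eval_X, eval_C, mul_inv, inv_pow, inv_inv,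
    mul_comm]

open Finset in
/-- A function `f` with `f 0 = 0` on a finite field is a monomial as soon as its slopes lie in a set
`D` and the sets `D` and `E ⊇ D / (D D)` are small and avoid `0`. -/
lemma exists_eq_mul_pow_of_slopes_mem {F : Type*} [Field F] [Fintype F]
    {D E : Finset F} (hD : 0 ∉ D) (hE : 0 ∉ E)
    (hDE : ∀ a ∈ D, ∀ b ∈ D, ∀ c ∈ D, a / (b * c) ∈ E)
    (hDcard : 2 * #D ≤ Fintype.card F + 1) (hEcard : 2 * #E ≤ Fintype.card F + 1)
    {f : F → F} (hf0 : f 0 = 0) (hf : ∀ x y : F, x ≠ y → (f x - f y) / (x - y) ∈ D) :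
    ∃ (a : F) (k : ℕ), a ≠ 0 ∧ 2 * k ≤ Fintype.card F ∧ ∀ x, f x = a * x ^ k := by
  have hquot {x : F} (hx : x ≠ 0) : f x / x ∈ D := by simpa [hf0] using hf x 0 hx
  have hf0' (x : F) : f x = 0 ↔ x = 0 := by
    refine ⟨fun h => ?_, fun h => h ▸ hf0⟩
    by_contra hx
    exact hD (by simpa [h] using hquot hx)
  have hg (x y : F) (hxy : x ≠ y) : ((f x⁻¹)⁻¹ - (f y⁻¹)⁻¹) / (x - y) ∈ E := by
    have hone {x : F} (hx : x ≠ 0) : (f x⁻¹)⁻¹ / x ∈ E := by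
      have h := hquot (inv_ne_zero hx)
      convert hDE _ h _ h _ h using 1
      have : f x⁻¹ ≠ 0 := by simpa [hf0'] using hx
      field_simp
    rcases eq_or_ne x 0 with rfl | hx
    · simpa [hf0, neg_div_neg_eq] using hone hxy.symm
    rcases eq_or_ne y 0 with rfl | hy
    · simpa [hf0] using hone hx
    have hfx : f x⁻¹ ≠ 0 := by simpa [hf0'] using hx
    have hfy : f y⁻¹ ≠ 0 := by simpa [hf0'] using hy
    have hxy' : x - y ≠ 0 := sub_ne_zero.mpr hxy
    convert hDE _ (hf x⁻¹ y⁻¹ (inv_injective.ne hxy)) _ (hquot (inv_ne_zero hx))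
      _ (hquot (inv_ne_zero hy)) using 1
    have hsub : x⁻¹ - y⁻¹ = -(x - y) / (x * y) := by field_simp; ring
    rw [hsub]
    generalize f x⁻¹ = s at *
    generalize f y⁻¹ = t at *
    field_simp
    ring
  obtain ⟨P, hPdeg, hP⟩ := exists_natDegree_lt_of_slopes_mem hD hf
  obtain ⟨Q, hQdeg, hQ⟩ := exists_natDegree_lt_of_slopes_mem hE hg
  have hq := Fintype.one_lt_card (α := F)
  exact exists_eq_mul_pow_of_natDegree_le hf0' (by omega) (by omega) hP hQ

open Polynomial in
/-- In characteristic `p`, if `(X + 1) ^ k = X ^ k + 1` with `k ≠ 0` then `k` is a power of `p`. -/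
lemma exists_eq_pow_of_X_add_one_pow {F : Type*} [Field F] {p : ℕ} (hp : p.Prime) [CharP F p]
    {k : ℕ} (hk : k ≠ 0) (h : (X + 1 : F[X]) ^ k = X ^ k + 1) : ∃ j, k = p ^ j := by
  have : Fact p.Prime := ⟨hp⟩
  obtain ⟨j, m, hm, rfl⟩ := Nat.exists_eq_pow_mul_and_not_dvd hk p hp.ne_one
  have hexp : (X + 1 : F[X]) ^ m = X ^ m + 1 := by
    apply expand_injective (R := F) (pow_pos hp.pos j)
    simpa [pow_mul, add_pow_char_pow] using h
  have hcoeff := congrArg (fun P => P.coeff 1) hexp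
  simp only [coeff_X_add_one_pow, Nat.choose_one_right, coeff_add, coeff_X_pow, coeff_one,
    one_ne_zero, if_false, add_zero] at hcoeff
  refine ⟨j, ?_⟩
  split_ifs at hcoeff with h1
  · rw [← h1, mul_one]
  · exact absurd ((CharP.cast_eq_zero_iff F p m).mp hcoeff) hm

open Finset in
/-- The Plünnecke–Ruzsa bound `|D / (D D)| ≤ c³ |D|` for a set of nonzero elements of a field with
`|D D| ≤ c |D|`. -/
lemma exists_finset_div_mul_mem {F : Type*} [Field F] [DecidableEq F]
    {D : Finset F} (hD : 0 ∉ D) (hne : D.Nonempty) {c : ℝ}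
    (hdd : (#(D * D) : ℝ) ≤ c * #D) :
    ∃ E : Finset F, 0 ∉ E ∧ (∀ a ∈ D, ∀ b ∈ D, ∀ c ∈ D, a / (b * c) ∈ E) ∧
      #D ≤ #E ∧ (#E : ℝ) ≤ c ^ 3 * #D := by
  have hlift : ∀ a ∈ D, ∃ u : Fˣ, (u : F) = a := fun a ha =>
    ⟨Units.mk0 a (ne_of_mem_of_not_mem ha hD), rfl⟩
  let A : Finset Fˣ := D.preimage Units.val Units.val_injective.injOn
  let φ : Fˣ ↪ F := ⟨Units.val, Units.val_injective⟩
  have hAD : A.map φ = D := by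
    ext a
    simp only [mem_map, A, mem_preimage]
    constructor
    · rintro ⟨u, hu, rfl⟩
      exact hu
    · intro ha
      obtain ⟨u, rfl⟩ := hlift a ha
      exact ⟨u, ha, rfl⟩
  have hA : #A = #D := by rw [← hAD, card_map]
  have hAA : #(A * A) = #(D * D) := by
    rw [← card_map φ, ← hAD, map_eq_image, map_eq_image]
    congr 1
    exact image_mul (Units.coeHom F)
  have hAne : A.Nonempty := by rw [← card_pos, hA]; exact hne.card_pos
  refine ⟨(A ^ 1 / A ^ 2).map φ, ?_, ?_, ?_, ?_⟩
  · simp [φ]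
  · intro a ha b hb d hd
    obtain ⟨a, rfl⟩ := hlift a ha
    obtain ⟨b, rfl⟩ := hlift b hb
    obtain ⟨d, rfl⟩ := hlift d hd
    refine mem_map.mpr ⟨a / (b * d), ?_, by simp [φ]⟩
    rw [pow_one, pow_two]
    exact div_mem_div (by simpa [A] using ha)
      (mul_mem_mul (by simpa [A] using hb) (by simpa [A] using hd))
  · rw [card_map, pow_one, ← hA]
    exact card_le_card_div_right hAne.pow
  · rw [card_map]
    have h := pluennecke_ruzsa_inequality_pow_div_pow_mul hAne A 1 2
    have hR : (#(A ^ 1 / A ^ 2) : ℝ) ≤ (#(A * A) / #A : ℝ) ^ 3 * #A := by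
      have h' := (NNRat.cast_le (K := ℝ)).mpr h
      push_cast at h'
      exact h'
    rw [hAA, hA] at hR
    have hpos : (0 : ℝ) < #D := by exact_mod_cast hne.card_pos
    refine hR.trans ?_
    gcongr
    exact (div_le_iff₀ hpos).mpr hdd

open Polynomial in
theorem stmt_1 {p n : ℕ} (hp : p.Prime) (hn : 0 < n)
    {F : Type*} [Field F] [Fintype F] (hF : Fintype.card F = p ^ n)
    (D : Set F) (hD : D ⊆ {0}ᶜ)
    (f : F → F) (hf : ∀ x y : F, x ≠ y → (f x - f y) / (x - y) ∈ D)
    (c : ℝ) (hc : 0 < c)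
    (hdd : ((D * D).ncard : ℝ) ≤ c * D.ncard)
    (hsmall : c ^ 3 * D.ncard ≤ (p ^ n + 1 : ℝ) / 2) :
    ∃ a b : F, ∃ j : ℕ, j ≤ n - 1 ∧ ∀ x : F, f x = a * x ^ (p ^ j) + b := by
  classical
  have : Fact p.Prime := ⟨hp⟩
  have : CharP F p := charP_of_card_eq_prime_pow hF
  lift D to Finset F using D.toFinite
  rw [← Finset.coe_mul, Set.ncard_coe_finset, Set.ncard_coe_finset] at hdd
  rw [Set.ncard_coe_finset] at hsmall
  simp only [Finset.mem_coe] at hf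
  have hD0 : 0 ∉ D := fun h => hD h rfl
  obtain ⟨E, hE0, hDE, hDEcard, hEcard⟩ :=
    exists_finset_div_mul_mem hD0 ⟨_, hf 1 0 one_ne_zero⟩ hdd
  have hE2 : 2 * E.card ≤ Fintype.card F + 1 := by
    have : (2 * E.card : ℝ) ≤ p ^ n + 1 := by linarith
    rw [hF]
    exact_mod_cast this
  have hmono (u : F) : ∃ (a : F) (k : ℕ), a ≠ 0 ∧ 2 * k ≤ Fintype.card F ∧
      ∀ x, f (x + u) - f u = a * x ^ k := by
    refine exists_eq_mul_pow_of_slopes_mem hD0 hE0 hDE (by omega) hE2 (by simp) fun x y hxy => ?_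
    simpa using hf (x + u) (y + u) (by simpa using hxy)
  obtain ⟨a, k, ha, hk, hfk⟩ := hmono 0
  obtain ⟨b, l, hb, hl, hfl⟩ := hmono 1
  have hq := Fintype.one_lt_card (α := F)
  have hk0 : k ≠ 0 := by
    rintro rfl
    exact ha (by simpa using (hfk 0).symm)
  have hpoly : C a * ((X + 1) ^ k - 1) = C b * X ^ l := by
    rw [← sub_eq_zero]
    refine eq_zero_of_natDegree_lt_card_of_eval_eq_zero' _ Finset.univ (fun x _ => ?_) ?_
    · have h1 := hfk (x + 1)
      have h2 := hfk 1
      have h3 := hfl x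
      simp only [add_zero, one_pow, mul_one] at h1 h2
      simp only [eval_sub, eval_mul, eval_C, eval_pow, eval_add, eval_X, eval_one]
      linear_combination h3 - h1 + h2
    · refine (natDegree_sub_le_of_le (m := max k l) (n := max k l) ?_ ?_).trans_lt ?_
      · refine (natDegree_C_mul_le _ _).trans ?_
        rw [← C_1, natDegree_sub_C, natDegree_pow, natDegree_X_add_C]
        simp
      · exact (natDegree_C_mul_X_pow_le _ _).trans (le_max_right _ _)
      · rw [Finset.card_univ]
        omega
  have hcoeff := congrArg (fun P => P.coeff k) hpoly
  simp only [coeff_C_mul, coeff_sub, coeff_X_add_one_pow, Nat.choose_self, Nat.cast_one,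
    coeff_one, hk0, if_false, sub_zero, mul_one, coeff_X_pow] at hcoeff
  have hkl : k = l := by
    by_contra hne
    exact ha (by simpa [hne] using hcoeff)
  subst hkl
  have hab : a = b := by simpa using hcoeff
  subst hab
  have hXk : (X + 1 : F[X]) ^ k = X ^ k + 1 := by
    rw [← sub_eq_iff_eq_add]
    exact mul_left_cancel₀ (C_ne_zero.mpr ha) hpoly
  obtain ⟨j, rfl⟩ := exists_eq_pow_of_X_add_one_pow hp hk0 hXk
  have hjn : j < n := by
    rw [← Nat.pow_lt_pow_iff_right hp.one_lt, ← hF]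
    omega
  refine ⟨a, f 0, j, by omega, fun x => ?_⟩
  rw [← hfk x, add_zero]
  ring
end

section
/- Let p be a prime, q = p^n, and D ⊆ 𝔽_q* with |D·D⁻¹·D⁻¹| ≤ (q+1)/2. If there exists a function f : 𝔽_q → 𝔽_q with f(0) = 0 whose direction set {(f(x)-f(y))/(x-y) : x ≠ y} equals D, then D = aK for some a ∈ 𝔽_q* and some subgroup K of 𝔽_q* of index p^r - 1 where r divides n. -/
open Pointwise

namespace Redei

open Polynomial

section Coefficients

variable {R : Type*} [CommRing R] {ι : Type*}

lemma coeff_zero_X_sub_C_mul (a : R) (P : R[X]) :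
    ((X - C a) * P).coeff 0 = -(a * P.coeff 0) := by
  simp [sub_mul]

lemma coeff_succ_X_sub_C_mul (a : R) (P : R[X]) (k : ℕ) :
    ((X - C a) * P).coeff (k + 1) = P.coeff k - a * P.coeff (k + 1) := by
  simp [sub_mul, coeff_X_mul]

lemma coeff_prod_X_sub_C_of_card_lt [Nontrivial R] (A : Finset ι) (c : ι → R) {k : ℕ}
    (hk : A.card < k) : (∏ x ∈ A, (X - C (c x))).coeff k = 0 :=
  coeff_eq_zero_of_natDegree_lt (by rwa [natDegree_finsetProd_X_sub_C_eq_card])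

/-- Scaling all roots by `t` scales the coefficients by powers of `t`. -/
lemma coeff_prod_X_sub_C_mul [Nontrivial R] (A : Finset ι) (t : R) (c : ι → R) :
    ∀ k j : ℕ, k + j = A.card →
      (∏ x ∈ A, (X - C (t * c x))).coeff k = t ^ j * (∏ x ∈ A, (X - C (c x))).coeff k := by
  classical
  induction A using Finset.induction_on with
  | empty =>
    intro k j h
    obtain ⟨rfl, rfl⟩ : k = 0 ∧ j = 0 := by simpa using h
    simp
  | insert a A ha ih =>
    intro k j h
    rw [Finset.card_insert_of_notMem ha] at h
    rw [Finset.prod_insert ha, Finset.prod_insert ha]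
    cases k with
    | zero =>
      obtain rfl : j = A.card + 1 := by omega
      rw [coeff_zero_X_sub_C_mul, coeff_zero_X_sub_C_mul, ih 0 A.card (by simp)]
      ring
    | succ k =>
      rw [coeff_succ_X_sub_C_mul, coeff_succ_X_sub_C_mul, ih k j (by omega)]
      cases j with
      | zero =>
        have hk : A.card < k + 1 := by omega
        rw [coeff_prod_X_sub_C_of_card_lt A _ hk, coeff_prod_X_sub_C_of_card_lt A _ hk]
        ring
      | succ j =>
        rw [ih (k + 1) j (by omega)]
        ring

/-- The coefficients of a product of linear forms `X - (b x - a x * Y)` have bounded degree in `Y`,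
with leading coefficients given by the homogeneous part. -/
lemma coeff_coeff_prod_linear [Nontrivial R] (A : Finset ι) (a b : ι → R) :
    ∀ k j : ℕ, A.card ≤ k + j →
      ((∏ x ∈ A, (X - C (C (b x) - C (a x) * X) : R[X][X])).coeff k).coeff j =
        if k + j = A.card then (∏ x ∈ A, (X - C (-a x))).coeff k else 0 := by
  classical
  induction A using Finset.induction_on with
  | empty =>
    intro k j _
    rcases Nat.eq_zero_or_pos k with rfl | hk
    · simp [coeff_one]
    · have : k ≠ 0 := by omega
      simp [coeff_one, this]
  | insert c A ha ih =>
    intro k j h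
    rw [Finset.card_insert_of_notMem ha] at h ⊢
    rw [Finset.prod_insert ha, Finset.prod_insert ha]
    have key : ∀ (P : R[X]), ((C (b c) - C (a c) * X) * P).coeff j =
        b c * P.coeff j - a c * (X * P).coeff j := by
      intro P
      rw [sub_mul, mul_assoc, coeff_sub, coeff_C_mul, coeff_C_mul]
    cases k with
    | zero =>
      obtain ⟨j, rfl⟩ : ∃ i, j = i + 1 := ⟨j - 1, by omega⟩
      rw [coeff_zero_X_sub_C_mul, coeff_zero_X_sub_C_mul, coeff_neg, key, coeff_X_mul,
        ih 0 j (by omega), ih 0 (j + 1) (by omega), if_neg (by omega)]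
      by_cases hj : 0 + j = A.card
      · rw [if_pos hj, if_pos (by omega)]; ring
      · rw [if_neg hj, if_neg (by omega)]; ring
    | succ k =>
      rw [coeff_succ_X_sub_C_mul, coeff_succ_X_sub_C_mul, coeff_sub, key,
        ih k j (by omega), ih (k + 1) j (by omega), if_neg (by omega : ¬ k + 1 + j = A.card)]
      cases j with
      | zero =>
        rw [coeff_prod_X_sub_C_of_card_lt A (fun x => -a x) (by omega : A.card < k + 1)]
        by_cases hj : k + 0 = A.card
        · rw [if_pos hj, if_pos (by omega), mul_coeff_zero]; simp
        · rw [if_neg hj, if_neg (by omega), mul_coeff_zero]; simp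
      | succ j =>
        rw [coeff_X_mul, ih (k + 1) j (by omega)]
        by_cases hj : k + (j + 1) = A.card
        · rw [if_pos hj, if_pos (by omega), if_pos (by omega)]; ring
        · rw [if_neg hj, if_neg (by omega), if_neg (by omega)]; ring

end Coefficients

variable {F : Type*} [Field F] [Fintype F]

/-- The Rédei polynomial of the graph of `f`. -/
noncomputable def redei (f : F → F) : F[X][X] :=
  ∏ x, (X - C (C (f x) - C x * X))

lemma prod_univ_X_sub_C : ∏ x : F, (X - C x) = X ^ Fintype.card F - X := by
  have hq : 1 < Fintype.card F := Fintype.one_lt_card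
  have hm : (X ^ Fintype.card F - X : F[X]).Monic := monic_X_pow_sub (by simpa using hq)
  have hr := FiniteField.roots_X_pow_card_sub_X F
  have := prod_multiset_X_sub_C_of_monic_of_roots_card_eq hm (by
    rw [hr, FiniteField.X_pow_card_sub_X_natDegree_eq F hq]; simp)
  rw [hr] at this
  exact this

lemma prod_X_sub_C_of_injective {g : F → F} (hg : Function.Injective g) :
    ∏ x : F, (X - C (g x)) = X ^ Fintype.card F - X := by
  rw [← prod_univ_X_sub_C]
  exact (Equiv.ofBijective g (Finite.injective_iff_bijective.mp hg)).prod_comp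
    (fun x => (X - C x : F[X]))

lemma coeff_X_pow_card_sub_X {k : ℕ} (h2 : 2 ≤ k) (hk : k < Fintype.card F) :
    (X ^ Fintype.card F - X : F[X]).coeff k = 0 := by
  rw [coeff_sub, coeff_X_pow, coeff_X, if_neg (by omega), if_neg (by omega), sub_zero]

lemma map_redei (f : F → F) (y : F) :
    (redei f).map (evalRingHom y) = ∏ x, (X - C (f x - x * y)) := by
  simp [redei, Polynomial.map_prod]

lemma eval_coeff_redei (f : F → F) (y : F) (k : ℕ) :
    ((redei f).coeff k).eval y = (∏ x, (X - C (f x - x * y))).coeff k := by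
  rw [← map_redei, coeff_map]; rfl

lemma monic_redei (f : F → F) : (redei f).Monic := monic_prod_X_sub_C _ _

lemma natDegree_redei (f : F → F) : (redei f).natDegree = Fintype.card F :=
  natDegree_finsetProd_X_sub_C_eq_card _ _

lemma coeff_coeff_redei_of_card_lt (f : F → F) {k j : ℕ} (h : Fintype.card F < k + j) :
    ((redei f).coeff k).coeff j = 0 := by
  rw [redei, coeff_coeff_prod_linear Finset.univ (fun x => x) f k j h.le,
    if_neg (by simpa using h.ne')]

lemma natDegree_coeff_redei_le (f : F → F) (k : ℕ) :
    ((redei f).coeff k).natDegree ≤ Fintype.card F - k := by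
  rw [natDegree_le_iff_coeff_eq_zero]
  intro j hj
  exact coeff_coeff_redei_of_card_lt f (by omega)

lemma natDegree_coeff_redei_lt (f : F → F) {k : ℕ} (h2 : 2 ≤ k) (hk : k < Fintype.card F) :
    ((redei f).coeff k).natDegree < Fintype.card F - k := by
  suffices ((redei f).coeff k).natDegree ≤ Fintype.card F - k - 1 by omega
  rw [natDegree_le_iff_coeff_eq_zero]
  intro j hj
  rcases (by omega : Fintype.card F < k + j ∨ Fintype.card F = k + j) with h | h
  · exact coeff_coeff_redei_of_card_lt f h
  · rw [redei, coeff_coeff_prod_linear Finset.univ (fun x => x) f k j h.le,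
      prod_X_sub_C_of_injective neg_injective, coeff_X_pow_card_sub_X h2 hk, ite_self]

lemma eval_coeff_redei_of_injective (f : F → F) {y : F}
    (hy : Function.Injective fun x => f x - x * y) {k : ℕ} (h2 : 2 ≤ k)
    (hk : k < Fintype.card F) : ((redei f).coeff k).eval y = 0 := by
  rw [eval_coeff_redei, prod_X_sub_C_of_injective hy, coeff_X_pow_card_sub_X h2 hk]

lemma eq_zero_of_forall_eval_eq_zero {P : F[X]} (hd : P.natDegree < Fintype.card F)
    (h : ∀ y, P.eval y = 0) : P = 0 :=
  eq_zero_of_natDegree_lt_card_of_eval_eq_zero P Function.injective_id h hd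

omit [Fintype F] in
lemma isCoprime_X_sub_C_pow {a b : F} (h : a ≠ b) (m n : ℕ) :
    IsCoprime ((X - C a) ^ m) ((X - C b) ^ n) :=
  (isCoprime_X_sub_C_of_isUnit_sub (sub_ne_zero.mpr h).isUnit).pow

lemma X_sub_C_dvd_X_pow_card_sub_X (a : F) : X - C a ∣ (X ^ Fintype.card F - X : F[X]) := by
  rw [dvd_iff_isRoot]
  simp [FiniteField.pow_card]

/-- Over a finite field, a product of linear factors divides its derivative times `X ^ q - X`. -/
lemma prod_X_sub_C_dvd_mul_derivative {ι : Type*} (A : Finset ι) (r : ι → F) :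
    ∏ x ∈ A, (X - C (r x)) ∣
      (X ^ Fintype.card F - X) * derivative (∏ x ∈ A, (X - C (r x))) := by
  classical
  have hcomp := Finset.prod_comp (s := A) (fun b : F => (X - C b : F[X])) r
  set h := ∏ x ∈ A, (X - C (r x)) with hh
  nth_rewrite 1 [hcomp]
  refine Finset.prod_dvd_of_coprime (fun a _ b _ hab => isCoprime_X_sub_C_pow hab _ _) ?_
  intro b hb
  have hdvd : (X - C b) ^ (A.filter fun x => r x = b).card ∣ h := by
    rw [hcomp]; exact Finset.dvd_prod_of_mem _ hb
  have hpos : 0 < (A.filter fun x => r x = b).card := by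
    obtain ⟨x, hx, rfl⟩ := Finset.mem_image.mp hb
    exact Finset.card_pos.mpr ⟨x, by simp [hx]⟩
  rw [← Nat.sub_add_cancel hpos, pow_succ']
  exact mul_dvd_mul (X_sub_C_dvd_X_pow_card_sub_X b) (pow_sub_one_dvd_derivative_of_pow_dvd hdvd)

/-- A fully reducible polynomial of degree `q` whose coefficients vanish in the upper half
(apart from the leading one) is either `X ^ q - X` or has zero derivative. -/
lemma derivative_eq_zero_or_of_lacunary (r : F → F)
    (hr : ∀ k, 2 ≤ k → k < Fintype.card F → Fintype.card F ≤ 2 * k →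
      (∏ x, (X - C (r x))).coeff k = 0) :
    derivative (∏ x, (X - C (r x))) = 0 ∨ ∏ x, (X - C (r x)) = X ^ Fintype.card F - X := by
  have hq : 1 < Fintype.card F := Fintype.one_lt_card
  have hdvd := prod_X_sub_C_dvd_mul_derivative Finset.univ r
  have hdeg : (∏ x, (X - C (r x))).natDegree = Fintype.card F :=
    natDegree_finsetProd_X_sub_C_eq_card _ _
  have hmon : (∏ x, (X - C (r x))).Monic := monic_prod_X_sub_C _ _
  set h := ∏ x, (X - C (r x)) with hh
  obtain ⟨g, hg⟩ : ∃ g, g = h - X ^ Fintype.card F := ⟨_, rfl⟩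
  have hgdeg : g.natDegree ≤ max 1 ((Fintype.card F - 1) / 2) := by
    rw [natDegree_le_iff_coeff_eq_zero]
    intro k hk
    rw [hg, coeff_sub, coeff_X_pow]
    rcases lt_trichotomy k (Fintype.card F) with hlt | heq | hgt
    · rw [hr k (by omega) hlt (by omega), if_neg (by omega), sub_zero]
    · rw [if_pos heq, heq, ← hdeg, hmon.coeff_natDegree, sub_self]
    · rw [coeff_eq_zero_of_natDegree_lt (by omega), if_neg (by omega), sub_zero]
  have hder : derivative h = derivative g := by
    rw [hg]; simp [derivative_X_pow]
  have hdvd' : h ∣ (g + X) * derivative g := by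
    have : (g + X) * derivative g =
        h * derivative h - (X ^ Fintype.card F - X) * derivative h := by
      rw [← hder, hg]; ring
    rw [this]
    exact dvd_sub (dvd_mul_right _ _) hdvd
  have hzero : (g + X) * derivative g = 0 := by
    refine eq_zero_of_dvd_of_natDegree_lt hdvd' ?_
    have h1 : (g + X).natDegree ≤ max 1 ((Fintype.card F - 1) / 2) :=
      (natDegree_add_le _ _).trans (max_le hgdeg (by simp))
    have h2 := natDegree_derivative_le g
    have h3 := natDegree_mul_le (p := g + X) (q := derivative g)
    omega
  rcases mul_eq_zero.mp hzero with h0 | h0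
  · right
    rw [hg] at h0
    linear_combination h0
  · left
    rw [hder, h0]

section FewDirections

variable {f : F → F} {B : Finset F}
  (hB : ∀ y ∉ B, Function.Injective fun x => f x - x * y)
  (hcard : 2 * B.card ≤ Fintype.card F + 1)

include hB hcard

lemma coeff_redei_eq_zero {k : ℕ} (h2 : 2 ≤ k) (hk : k < Fintype.card F)
    (hk' : Fintype.card F ≤ 2 * k) : (redei f).coeff k = 0 := by
  classical
  refine eq_zero_of_natDegree_lt_card_of_eval_eq_zero' _ Bᶜ (fun y hy => ?_) ?_
  · exact eval_coeff_redei_of_injective f (hB y (by simpa using hy)) h2 hk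
  · have := natDegree_coeff_redei_lt f h2 hk
    rw [Finset.card_compl]
    omega

lemma derivative_redei : derivative (redei f) = C ((redei f).coeff 1) := by
  have hq : 1 < Fintype.card F := Fintype.one_lt_card
  ext1 k
  cases k with
  | zero => simp [coeff_derivative]
  | succ k =>
    rw [coeff_C_succ]
    by_cases hk : Fintype.card F < k + 2
    · exact coeff_eq_zero_of_natDegree_lt (by
        have := natDegree_derivative_le (redei f)
        rw [natDegree_redei] at this
        omega)
    refine eq_zero_of_forall_eval_eq_zero ?_ fun y => ?_
    · rw [coeff_derivative]
      have h1 := natDegree_coeff_redei_le f (k + 1 + 1)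
      have h2 : ((((k + 1 : ℕ) : F[X]) + 1)).natDegree = 0 := by
        rw [← Nat.cast_succ]; exact natDegree_natCast _
      have h3 := natDegree_mul_le (p := (redei f).coeff (k + 1 + 1)) (q := ((k + 1 : ℕ) : F[X]) + 1)
      omega
    · have hmap : ((derivative (redei f)).coeff (k + 1)).eval y =
          (derivative (∏ x, (X - C (f x - x * y)))).coeff (k + 1) := by
        rw [← map_redei, derivative_map, coeff_map]; rfl
      rw [hmap]
      rcases derivative_eq_zero_or_of_lacunary (fun x => f x - x * y) (fun k h2 hk hk' => by
        rw [← eval_coeff_redei, coeff_redei_eq_zero hB hcard h2 hk hk', eval_zero]) with h | h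
      · rw [h, coeff_zero]
      · rw [h]
        simp [derivative_X_pow, coeff_one]

/-- The product of the differences of linear forms from a point of the graph does not depend on
the point. -/
lemma prod_erase_eq_coeff_one [DecidableEq F] (u : F) :
    ∏ x ∈ Finset.univ.erase u, ((C (f u) - C u * X) - (C (f x) - C x * X) : F[X]) =
      (redei f).coeff 1 := by
  have h1 : (derivative (redei f)).eval (C (f u) - C u * X) = (redei f).coeff 1 := by
    rw [derivative_redei hB hcard, eval_C]
  rw [← h1, redei, ← Finset.mul_prod_erase _ _ (Finset.mem_univ u)]
  simp [derivative_mul, eval_prod]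

/-- Every line in a given direction that meets the graph does so in the same number of points. -/
lemma card_fiber_eq [DecidableEq F] (d u v : F) :
    (Finset.univ.filter fun x => f x - x * d = f u - u * d).card =
      (Finset.univ.filter fun x => f x - x * d = f v - v * d).card := by
  have key : ∀ w : F, (Finset.univ.filter fun x => f x - x * d = f w - w * d).card =
      ((redei f).coeff 1).rootMultiplicity d + 1 := by
    intro w
    have hne : ∀ x ∈ Finset.univ.erase w,
        ((C (f w) - C w * X) - (C (f x) - C x * X) : F[X]) =
          C (x - w) * (X - C ((f x - f w) / (x - w))) := by
      intro x hx
      have hxw : x - w ≠ 0 := sub_ne_zero.mpr (Finset.ne_of_mem_erase hx)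
      rw [mul_sub, ← C_mul, mul_div_cancel₀ _ hxw]
      simp only [C_sub]
      ring
    have hunit : ∏ x ∈ Finset.univ.erase w, (x - w) ≠ 0 :=
      Finset.prod_ne_zero_iff.mpr fun x hx => sub_ne_zero.mpr (Finset.ne_of_mem_erase hx)
    rw [← prod_erase_eq_coeff_one hB hcard w, Finset.prod_congr rfl hne, Finset.prod_mul_distrib,
      ← map_prod, ← count_roots, roots_C_mul _ hunit,
      roots_prod _ _ (Finset.prod_ne_zero_iff.mpr fun x _ => X_sub_C_ne_zero _)]
    simp only [roots_X_sub_C, Multiset.count_bind, Multiset.count_singleton]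
    have hfil : (Finset.univ.filter fun x => f x - x * d = f w - w * d) =
        insert w ((Finset.univ.erase w).filter fun x => d = (f x - f w) / (x - w)) := by
      ext x
      by_cases hx : x = w
      · simp [hx]
      · have hxw : x - w ≠ 0 := sub_ne_zero.mpr hx
        simp only [Finset.mem_filter, Finset.mem_univ, true_and, Finset.mem_insert, hx, false_or,
          Finset.mem_erase, ne_eq, not_false_eq_true, and_true, eq_div_iff hxw]
        constructor <;> intro h <;> linear_combination -h
    rw [hfil, Finset.card_insert_of_notMem (by simp), Finset.card_filter]
    rfl
  rw [key u, key v]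

/-- The inverse of `f` is given by a polynomial of small degree. -/
lemma exists_polynomial_inverse (hf : Function.Injective f) :
    ∃ P : F[X], P.natDegree ≤ max 1 ((Fintype.card F - 1) / 2) ∧ ∀ u, P.eval (f u) = u := by
  classical
  set Q : F[X] := ∑ k ∈ Finset.range (Fintype.card F + 1),
    C (((redei f).coeff k).coeff 1) * X ^ k with hQ
  have hcoeff : ∀ k, Q.coeff k = if k < Fintype.card F + 1 then
      ((redei f).coeff k).coeff 1 else 0 := by
    intro k
    simp [hQ, coeff_X_pow]
  have heval : ∀ z, Q.eval z = ((redei f).eval (C z)).coeff 1 := by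
    intro z
    rw [eval_eq_sum_range (p := redei f) (C z), natDegree_redei, finsetSum_coeff, hQ,
      eval_finsetSum]
    refine Finset.sum_congr rfl fun k _ => ?_
    rw [← C_pow, coeff_mul_C]
    simp
  refine ⟨-Q, ?_, fun u => ?_⟩
  · rw [natDegree_neg, natDegree_le_iff_coeff_eq_zero]
    intro k hk
    rw [hcoeff]
    rcases lt_trichotomy k (Fintype.card F) with hlt | heq | hgt
    · rw [coeff_redei_eq_zero hB hcard (by omega) hlt (by omega), coeff_zero, ite_self]
    · have : (redei f).coeff k = 1 := by
        rw [heq, ← natDegree_redei f, (monic_redei f).coeff_natDegree]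
      rw [this]
      simp [coeff_one]
    · rw [if_neg (by omega)]
  · have hprod : ∏ x ∈ Finset.univ.erase u, (f u - f x) = -1 := by
      have h1 : (derivative (∏ x, (X - C (f x)))).eval (f u) = -1 := by
        rw [prod_X_sub_C_of_injective hf]
        simp [derivative_X_pow]
      rw [← h1, ← Finset.mul_prod_erase _ _ (Finset.mem_univ u)]
      simp [derivative_mul, eval_prod]
    rw [eval_neg, heval, redei, eval_prod, ← Finset.mul_prod_erase _ _ (Finset.mem_univ u)]
    have h2 : ((C (f u) - (C (f u) - C u * X) : F[X])) = X * C u := by ring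
    simp only [eval_sub, eval_X, eval_C]
    rw [h2, mul_assoc, coeff_X_mul, mul_coeff_zero, coeff_C_zero, coeff_zero_eq_eval_zero,
      eval_prod]
    simp [hprod]

end FewDirections

lemma exists_coeff_mul_eq {R : Type*} [CommRing R] {P Q : R[X]} {t : R} {a : ℕ → R} {s k : ℕ}
    (hks : k ≤ s) (hP : ∀ i ≤ k, P.coeff i = t ^ (s - i) * a i) :
    ∃ c, (P * Q).coeff k = t ^ (s - k) * (a k * Q.coeff 0 + t * c) := by
  have hdvd : t ^ (s - k + 1) ∣ ∑ i ∈ Finset.range k, P.coeff i * Q.coeff (k - i) := by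
    refine Finset.dvd_sum fun i hi => Dvd.dvd.mul_right ?_ _
    have hik := Finset.mem_range.mp hi
    rw [hP i hik.le]
    exact (pow_dvd_pow t (by omega)).mul_right _
  obtain ⟨c, hc⟩ := hdvd
  refine ⟨c, ?_⟩
  rw [coeff_mul, Finset.Nat.sum_antidiagonal_eq_sum_range_succ_mk, Finset.sum_range_succ, hc,
    hP k le_rfl, Nat.sub_self]
  ring

section Slopes

variable [DecidableEq F]

/-- The abscissae of the points of the graph of `g` on the line of slope `d` through the origin. -/
def slopeSet (g : F → F) (d : F) : Finset F := Finset.univ.filter fun x => g x = x * d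

lemma mem_slopeSet {g : F → F} {d x : F} : x ∈ slopeSet g d ↔ g x = x * d := by
  simp [slopeSet]

lemma redei_eq_mul (g : F → F) (d : F) :
    redei g = (∏ x ∈ slopeSet g d, (X - C ((C d - X) * C x))) *
      ∏ x ∈ Finset.univ.filter (fun x => ¬ g x = x * d), (X - C (C (g x) - C x * X)) := by
  rw [redei, ← Finset.prod_filter_mul_prod_filter_not Finset.univ (fun x => g x = x * d)]
  congr 1
  refine Finset.prod_congr rfl fun x hx => ?_
  rw [mem_slopeSet.mp hx, C_mul]
  congr 2
  ring

/-- The expansion of a coefficient of the Rédei polynomial around a slope `d`. -/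
lemma exists_coeff_redei_eq (g : F → F) (d : F) {k : ℕ} (hk : k ≤ (slopeSet g d).card) :
    ∃ c e : F[X], (redei g).coeff k = (C d - X) ^ ((slopeSet g d).card - k) *
      (C ((∏ x ∈ slopeSet g d, (X - C x)).coeff k) * e + (C d - X) * c) ∧ e.eval d ≠ 0 := by
  have hmap : (∏ x ∈ slopeSet g d, (X - C (C x)) : F[X][X]) =
      (∏ x ∈ slopeSet g d, (X - C x)).map C := by
    simp [Polynomial.map_prod]
  obtain ⟨c, hc⟩ := exists_coeff_mul_eq (P := ∏ x ∈ slopeSet g d, (X - C ((C d - X) * C x)))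
    (Q := ∏ x ∈ Finset.univ.filter (fun x => ¬ g x = x * d), (X - C (C (g x) - C x * X)))
    (t := C d - X) (a := fun i => C ((∏ x ∈ slopeSet g d, (X - C x)).coeff i)) hk
    (fun i hi => by
      rw [coeff_prod_X_sub_C_mul _ _ _ i ((slopeSet g d).card - i) (by omega), hmap, coeff_map])
  refine ⟨c, _, by rw [redei_eq_mul g d, hc], ?_⟩
  rw [coeff_zero_eq_eval_zero, eval_prod, eval_prod, Finset.prod_ne_zero_iff]
  intro x hx
  have hx' := (Finset.mem_filter.mp hx).2
  simpa [sub_eq_zero, eq_comm] using hx'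

lemma X_sub_C_pow_dvd_coeff_redei (g : F → F) (d : F) (k : ℕ) :
    (X - C d) ^ ((slopeSet g d).card - k) ∣ (redei g).coeff k := by
  rcases le_total k (slopeSet g d).card with hk | hk
  · obtain ⟨c, e, h, -⟩ := exists_coeff_redei_eq g d hk
    rw [h, ← neg_sub X (C d), neg_pow]
    exact (dvd_mul_left _ _).mul_right _
  · simp [Nat.sub_eq_zero_of_le hk]

lemma coeff_card_slopeSet_ne_zero (g : F → F) (d : F) :
    (redei g).coeff (slopeSet g d).card ≠ 0 := by
  obtain ⟨c, e, h, he⟩ := exists_coeff_redei_eq g d le_rfl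
  intro h0
  have h1 : (∏ x ∈ slopeSet g d, (X - C x)).coeff (slopeSet g d).card = 1 := by
    have := (monic_prod_X_sub_C (fun x : F => x) (slopeSet g d)).coeff_natDegree
    rwa [natDegree_finsetProd_X_sub_C_eq_card] at this
  rw [h0, h1, Nat.sub_self, pow_zero, one_mul] at h
  apply he
  have := congrArg (eval d) h
  simpa using this.symm

section Minimal

variable {g : F → F} {B : Finset F} {s : ℕ}
  (hB : ∀ y ∉ B, Function.Injective fun x => g x - x * y)
  (hmin : ∀ d ∈ B, s ≤ (slopeSet g d).card)

include hB

lemma sum_card_slopeSet_sub_lt {d₀ : F} (h₀ : (slopeSet g d₀).card = s) (h2 : 2 ≤ s)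
    (hs : s < Fintype.card F) :
    ∑ d ∈ B, ((slopeSet g d).card - s) + (Fintype.card F - B.card) < Fintype.card F - s := by
  refine lt_of_le_of_lt ?_ (natDegree_coeff_redei_lt g h2 hs)
  have hdvd : (∏ d ∈ B, (X - C d) ^ ((slopeSet g d).card - s)) * ∏ d ∈ Bᶜ, (X - C d) ∣
      (redei g).coeff s := by
    refine IsCoprime.mul_dvd ?_ ?_ ?_
    · refine IsCoprime.prod_left fun a ha => IsCoprime.prod_right fun b hb => ?_
      rw [← pow_one (X - C b)]
      refine isCoprime_X_sub_C_pow ?_ _ _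
      rintro rfl
      exact Finset.mem_compl.mp hb ha
    · exact Finset.prod_dvd_of_coprime (fun a _ b _ hab => isCoprime_X_sub_C_pow hab _ _)
        fun d _ => X_sub_C_pow_dvd_coeff_redei g d s
    · refine Finset.prod_dvd_of_coprime (fun a _ b _ hab => ?_) fun y hy => ?_
      · simpa using isCoprime_X_sub_C_pow hab 1 1
      · rw [dvd_iff_isRoot]
        exact eval_coeff_redei_of_injective g (hB y (Finset.mem_compl.mp hy)) h2 hs
  have hle := natDegree_le_of_dvd hdvd (h₀ ▸ coeff_card_slopeSet_ne_zero g d₀)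
  rw [Monic.natDegree_mul (monic_prod_of_monic _ _ fun d _ => (monic_X_sub_C d).pow _)
    (monic_prod_X_sub_C _ _), natDegree_prod_of_monic _ _ fun d _ => (monic_X_sub_C d).pow _,
    natDegree_finsetProd_X_sub_C_eq_card, Finset.card_compl] at hle
  simpa using hle

include hmin

lemma coeff_redei_eq_zero_of_lt {k : ℕ} (h2 : 2 ≤ k) (hk : k < s) (hs : s ≤ Fintype.card F) :
    (redei g).coeff k = 0 := by
  refine eq_zero_of_forall_eval_eq_zero ?_ fun y => ?_
  · have := natDegree_coeff_redei_le g k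
    omega
  · by_cases hy : y ∈ B
    · have h1 := hmin y hy
      have h3 : X - C y ∣ (redei g).coeff k :=
        (dvd_pow_self _ (by omega)).trans (X_sub_C_pow_dvd_coeff_redei g y k)
      exact dvd_iff_isRoot.mp h3
    · exact eval_coeff_redei_of_injective g (hB y hy) h2 (by omega)

lemma exists_mem_slopeSet_iff {d : F} (hd : (slopeSet g d).card = s) (h2 : 2 ≤ s)
    (hs : s ≤ Fintype.card F) (hg : g 0 = 0) :
    ∃ c : F, ∀ x, x ∈ slopeSet g d ↔ x * (x ^ (s - 1) + c) = 0 := by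
  have hcoeff : ∀ k, 2 ≤ k → k < s → (∏ x ∈ slopeSet g d, (X - C x)).coeff k = 0 := by
    intro k hk hks
    obtain ⟨c, e, h, he⟩ := exists_coeff_redei_eq g d (k := k) (by omega)
    rw [coeff_redei_eq_zero_of_lt hB hmin hk hks hs, eq_comm, mul_eq_zero] at h
    have hne : (C d - X : F[X]) ≠ 0 := by
      rw [← neg_sub, neg_ne_zero]; exact X_sub_C_ne_zero d
    have h' := h.resolve_left (pow_ne_zero _ hne)
    have := congrArg (eval d) h'
    simpa [he] using this
  have h0 : (0 : F) ∈ slopeSet g d := by simp [mem_slopeSet, hg]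
  set P := ∏ x ∈ slopeSet g d, (X - C x) with hP
  have hroot : ∀ x, x ∈ slopeSet g d ↔ P.eval x = 0 := by
    intro x
    rw [hP, eval_prod, Finset.prod_eq_zero_iff]
    simp [sub_eq_zero]
  have hdeg : P.natDegree = s := by rw [hP, natDegree_finsetProd_X_sub_C_eq_card, hd]
  have hmon : P.Monic := monic_prod_X_sub_C _ _
  have hform : P = X ^ s + C (P.coeff 1) * X := by
    ext k
    rw [coeff_add, coeff_X_pow, coeff_C_mul, coeff_X]
    rcases Nat.lt_or_ge k 2 with hk | hk
    · interval_cases k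
      · rw [coeff_zero_eq_eval_zero, (hroot 0).mp h0, if_neg (by omega), if_neg (by omega)]
        simp
      · rw [if_neg (by omega), if_pos rfl]; simp
    · rw [if_neg (by omega : ¬ 1 = k), mul_zero, add_zero]
      rcases lt_trichotomy k s with h | h | h
      · rw [hcoeff k hk h, if_neg h.ne]
      · rw [if_pos h, h, ← hdeg, hmon.coeff_natDegree]
      · rw [coeff_eq_zero_of_natDegree_lt (by omega), if_neg h.ne']
  refine ⟨P.coeff 1, fun x => ?_⟩
  have hx : P.eval x = x * (x ^ (s - 1) + P.coeff 1) := by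
    conv_lhs => rw [hform]
    rw [mul_add, ← pow_succ', Nat.sub_add_cancel (by omega)]
    rw [eval_add, eval_pow, eval_mul, eval_X, eval_C, mul_comm x]
  rw [hroot, hx]

lemma apply_mul_of_mem_slopeSet {d l x : F} (hd : (slopeSet g d).card = s) (h2 : 2 ≤ s)
    (hs : s ≤ Fintype.card F) (hg : g 0 = 0) (hl : l ^ (s - 1) = 1) (hx : x ∈ slopeSet g d) :
    g (l * x) = l * g x := by
  obtain ⟨c, hc⟩ := exists_mem_slopeSet_iff hB hmin hd h2 hs hg
  have h1 : l * x ∈ slopeSet g d := by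
    rw [hc, mul_pow, hl, one_mul, mul_assoc, (hc x).mp hx, mul_zero]
  rw [mem_slopeSet.mp h1, mem_slopeSet.mp hx, mul_assoc]

lemma exists_pow_eq_one {d : F} (hd : (slopeSet g d).card = s) (h3 : 3 ≤ s)
    (hs : s ≤ Fintype.card F) (hg : g 0 = 0) :
    ∃ l : F, l ≠ 0 ∧ l ≠ 1 ∧ l ^ (s - 1) = 1 := by
  obtain ⟨c, hc⟩ := exists_mem_slopeSet_iff hB hmin hd (by omega) hs hg
  have h0 : (0 : F) ∈ slopeSet g d := by simp [mem_slopeSet, hg]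
  have hcard : 1 < ((slopeSet g d).erase 0).card := by
    rw [Finset.card_erase_of_mem h0]; omega
  obtain ⟨x, hx, y, hy, hxy⟩ := Finset.one_lt_card.mp hcard
  rw [Finset.mem_erase, hc] at hx hy
  have hx' := (mul_eq_zero.mp hx.2).resolve_left hx.1
  have hy' := (mul_eq_zero.mp hy.2).resolve_left hy.1
  refine ⟨x / y, div_ne_zero hx.1 hy.1, fun h => hxy ((div_eq_one_iff_eq hy.1).mp h), ?_⟩
  rw [div_pow, div_eq_one_iff_eq (pow_ne_zero _ hy.1)]
  linear_combination hx' - hy'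

end Minimal

end Slopes

section Additive

variable [DecidableEq F]

lemma card_slopeSet_translate {f : F → F} (hf0 : f 0 = 0)
    (hfib : ∀ d u v : F, (Finset.univ.filter fun x => f x - x * d = f u - u * d).card =
      (Finset.univ.filter fun x => f x - x * d = f v - v * d).card) (u d : F) :
    (slopeSet (fun x => f (x + u) - f u) d).card = (slopeSet f d).card := by
  have h1 : slopeSet f d = Finset.univ.filter fun x => f x - x * d = f 0 - 0 * d := by
    ext x
    simp [mem_slopeSet, hf0, sub_eq_zero]
  rw [h1, ← hfib d u 0]
  refine Finset.card_equiv (Equiv.addRight u) fun x => ?_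
  rw [mem_slopeSet]
  simp only [Finset.mem_filter, Finset.mem_univ, true_and, Equiv.coe_addRight]
  constructor <;> intro h <;> linear_combination h

lemma card_slopeSet_dvd {f : F → F} (hf0 : f 0 = 0)
    (hfib : ∀ d u v : F, (Finset.univ.filter fun x => f x - x * d = f u - u * d).card =
      (Finset.univ.filter fun x => f x - x * d = f v - v * d).card) (d : F) :
    (slopeSet f d).card ∣ Fintype.card F := by
  have h1 : slopeSet f d = Finset.univ.filter fun x => f x - x * d = f 0 - 0 * d := by
    ext x
    simp [mem_slopeSet, hf0, sub_eq_zero]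
  have h2 := Finset.card_eq_sum_card_image (fun x => f x - x * d) Finset.univ
  rw [← Finset.card_univ, h2]
  refine Finset.dvd_sum fun b hb => ?_
  obtain ⟨u, -, rfl⟩ := Finset.mem_image.mp hb
  rw [h1, hfib d 0 u]

/-- The nonzero points of the graph are partitioned by their slopes. -/
lemma sum_card_slopeSet_sub_one {g : F → F} (hg : g 0 = 0) (S : Finset F) :
    ∑ d ∈ S, ((slopeSet g d).card - 1) =
      ((Finset.univ.erase 0).filter fun x => g x / x ∈ S).card := by
  have hmaps : ∀ x ∈ (Finset.univ.erase 0).filter fun x => g x / x ∈ S, g x / x ∈ S :=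
    fun x hx => (Finset.mem_filter.mp hx).2
  rw [Finset.card_eq_sum_card_fiberwise hmaps]
  refine Finset.sum_congr rfl fun d hd => ?_
  have h0 : (0 : F) ∈ slopeSet g d := by simp [mem_slopeSet, hg]
  rw [← Finset.card_erase_of_mem h0]
  congr 1
  ext x
  simp only [Finset.mem_erase, mem_slopeSet, Finset.mem_filter, Finset.mem_univ, and_true]
  constructor
  · rintro ⟨hx, h⟩
    have : g x / x = d := by rw [h, mul_div_cancel_left₀ _ hx]
    exact ⟨⟨hx, this ▸ hd⟩, this⟩
  · rintro ⟨⟨hx, -⟩, h⟩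
    exact ⟨hx, by rw [← h, mul_div_cancel₀ _ hx]⟩

omit [Fintype F] [DecidableEq F] in
/-- A function compatible with one nontrivial affine combination is additive. -/
lemma map_add_of_affine {φ : F → F} {l : F} (h0 : φ 0 = 0) (hl0 : l ≠ 0) (hl1 : l ≠ 1)
    (h : ∀ b z, φ (b + l * z) = φ b + l * (φ (b + z) - φ b)) (v w : F) :
    φ (v + w) = φ v + φ w := by
  have hl1' : 1 - l ≠ 0 := sub_ne_zero.mpr hl1.symm
  have hw := h 0 (w / l)
  have hv := h (v / (1 - l)) (-(v / (1 - l)))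
  have hvw := h (v / (1 - l)) (w / l - v / (1 - l))
  rw [mul_div_cancel₀ _ hl0] at hw
  have e1 : v / (1 - l) + l * -(v / (1 - l)) = v := by field_simp; ring
  have e2 : v / (1 - l) + l * (w / l - v / (1 - l)) = v + w := by field_simp; ring
  rw [e1, add_neg_cancel] at hv
  rw [e2, add_sub_cancel] at hvw
  rw [zero_add, zero_add] at hw
  rw [h0] at hw hv
  linear_combination hvw - hv - hw

/-- If the slopes of multiplicity `s` cover more points than the degree of the inverse polynomial,
then `f` is additive. -/
lemma map_add_of_polynomial_inverse {f : F → F} (hf0 : f 0 = 0) (hf : Function.Injective f)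
    {P : F[X]} (hP : ∀ u, P.eval (f u) = u) {l : F} (hl0 : l ≠ 0) (hl1 : l ≠ 1)
    (hcov : ∀ u, P.natDegree < (Finset.univ.filter fun x =>
      f (l * x + u) - f u = l * (f (x + u) - f u)).card) (v w : F) :
    f (v + w) = f v + f w := by
  have hsurj : Function.Surjective f := Finite.injective_iff_surjective.mp hf
  have key : ∀ b z, P.eval (b + l * z) = P.eval b + l * (P.eval (b + z) - P.eval b) := by
    intro b z
    obtain ⟨u, rfl⟩ := hsurj b
    set H : F[X] := P.comp (C (f u) + C l * X) - C u - C l * (P.comp (C (f u) + X) - C u) with hH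
    have hevalH : ∀ z, H.eval z =
        P.eval (f u + l * z) - u - l * (P.eval (f u + z) - u) := by
      intro z; simp [hH]
    have hdeg : H.natDegree ≤ P.natDegree := by
      have h1 : (P.comp (C (f u) + C l * X)).natDegree ≤ P.natDegree := by
        refine natDegree_comp_le.trans ?_
        refine (Nat.mul_le_mul_left _ (?_ : _ ≤ 1)).trans (mul_one _).le
        compute_degree
      have h2 : (P.comp (C (f u) + X)).natDegree ≤ P.natDegree := by
        refine natDegree_comp_le.trans ?_
        refine (Nat.mul_le_mul_left _ (?_ : _ ≤ 1)).trans (mul_one _).le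
        compute_degree
      refine (natDegree_sub_le _ _).trans (max_le ?_ ?_)
      · rw [natDegree_sub_C]; exact h1
      · refine (natDegree_C_mul_le _ _).trans ?_
        rw [natDegree_sub_C]; exact h2
    have hzero : H = 0 := by
      refine eq_zero_of_natDegree_lt_card_of_eval_eq_zero' H
        ((Finset.univ.filter fun x => f (l * x + u) - f u = l * (f (x + u) - f u)).image
          fun x => f (x + u) - f u) ?_ ?_
      · intro z hz
        obtain ⟨x, hx, rfl⟩ := Finset.mem_image.mp hz
        rw [hevalH, ← (Finset.mem_filter.mp hx).2, add_sub_cancel, add_sub_cancel, hP, hP]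
        ring
      · rw [Finset.card_image_of_injective _ fun x y hxy => by
          simpa using hf (sub_left_injective hxy)]
        exact hdeg.trans_lt (hcov u)
    have := hevalH z
    rw [hzero, eval_zero] at this
    rw [hP]
    linear_combination -this
  have h0 : P.eval 0 = 0 := by simpa [hf0] using hP 0
  obtain ⟨u, hu⟩ := hsurj (f v + f w)
  have := hP u
  rw [hu, map_add_of_affine (φ := fun z => P.eval z) h0 hl0 hl1 key, hP, hP] at this
  rw [this, hu]

omit [DecidableEq F] in
/-- Consecutive divisors of the order of a finite field are far apart. -/
lemma exists_gap_of_dvd {s : ℕ} (h3 : 3 ≤ s) (hs : s ∣ Fintype.card F) :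
    ∃ g, 2 * s + 2 * g ≤ s * g + 2 ∧ ∀ m, m ∣ Fintype.card F → s < m → s + g ≤ m := by
  obtain ⟨p, hchar⟩ := CharP.exists F
  obtain ⟨n, hp, hn⟩ := FiniteField.card F p
  rw [hn] at hs ⊢
  obtain ⟨i, -, rfl⟩ := (Nat.dvd_prime_pow hp).mp hs
  obtain ⟨c, rfl⟩ : ∃ c, p = c + 2 := ⟨p - 2, by have := hp.two_le; omega⟩
  refine ⟨(c + 1) * (c + 2) ^ i, ?_, fun m hm hlt => ?_⟩
  · rcases Nat.eq_zero_or_pos c with rfl | hc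
    · have h4 : 4 ≤ 2 ^ i := by
        rcases Nat.lt_or_ge i 2 with hi | hi
        · interval_cases i <;> simp at h3
        · exact Nat.pow_le_pow_right (n := 2) (by norm_num) hi
      simp only [zero_add, one_mul]
      nlinarith
    · generalize (c + 2) ^ i = s at h3
      have : 2 * s ≤ (c + 1) * s := Nat.mul_le_mul_right _ (by omega)
      nlinarith
  · obtain ⟨j, -, rfl⟩ := (Nat.dvd_prime_pow hp).mp hm
    have hij : i + 1 ≤ j := (Nat.pow_lt_pow_iff_right hp.one_lt).mp hlt
    calc (c + 2) ^ i + (c + 1) * (c + 2) ^ i = (c + 2) ^ (i + 1) := by ring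
      _ ≤ (c + 2) ^ j := Nat.pow_le_pow_right (by omega) hij

lemma le_two_mul_of_gap {q s g M N : ℕ} (hs : 3 ≤ s) (hg : 2 * s + 2 * g ≤ s * g + 2)
    (hsN : q + s ≤ s * (N + M)) (hq : N * (s - 1) + M * (s + g - 1) ≤ q - 1) :
    q ≤ 2 * ((s - 1) * N) := by
  obtain ⟨m, rfl⟩ : ∃ m, s = m + 1 := ⟨s - 1, by omega⟩
  obtain ⟨e, rfl⟩ : ∃ e, g = e + 1 := ⟨g - 1, by
    rcases Nat.eq_zero_or_pos g with rfl | h <;> omega⟩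
  rw [show m + 1 + (e + 1) - 1 = m + e + 1 by omega, Nat.add_sub_cancel] at hq
  rw [Nat.add_sub_cancel]
  replace hq := hq.trans (Nat.sub_le q 1)
  have h1 : e * q ≤ (m + 1) * (e + 1) * N := by nlinarith
  have h2 : (m + 1) * (e + 1) ≤ 2 * m * e := by nlinarith
  refine le_of_mul_le_mul_left (a := (m + 1) * (e + 1)) ?_ (by positivity)
  calc (m + 1) * (e + 1) * q ≤ 2 * m * e * q := Nat.mul_le_mul_right _ h2
    _ = 2 * m * (e * q) := by ring
    _ ≤ 2 * m * ((m + 1) * (e + 1) * N) := Nat.mul_le_mul_left _ h1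
    _ = _ := by ring

/-- An injective function with at most `(q + 1) / 2` directions is additive. -/
theorem map_add_of_card_directions_le {f : F → F} (hf0 : f 0 = 0) (hf : Function.Injective f)
    {B : Finset F} (hB : ∀ y, y ∉ B ↔ Function.Injective fun x => f x - x * y)
    (hcard : 2 * B.card ≤ Fintype.card F + 1) (v w : F) : f (v + w) = f v + f w := by
  have hB' : ∀ y ∉ B, Function.Injective fun x => f x - x * y := fun y => (hB y).mp
  have hfib := card_fiber_eq hB' hcard
  obtain ⟨P, hPdeg, hP⟩ := exists_polynomial_inverse hB' hcard hf
  have hpos : ∀ d, 1 ≤ (slopeSet f d).card := fun d =>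
    Finset.card_pos.mpr ⟨0, by simp [mem_slopeSet, hf0]⟩
  have hnotmem : ∀ d, d ∉ B ↔ (slopeSet f d).card = 1 := by
    intro d
    constructor
    · intro hd
      rw [Finset.card_eq_one]
      refine ⟨0, Finset.eq_singleton_iff_unique_mem.mpr ⟨by simp [mem_slopeSet, hf0], ?_⟩⟩
      intro x hx
      exact hB' d hd (by simp [mem_slopeSet.mp hx, hf0])
    · intro hd
      rw [hB]
      intro a b hab
      have h1 : (Finset.univ.filter fun x => f x - x * d = f b - b * d).card = 1 := by
        rw [hfib d b 0, ← hd]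
        congr 1
        ext x
        simp [mem_slopeSet, hf0, sub_eq_zero]
      exact Finset.card_le_one.mp h1.le a (by simpa using hab) b (by simp)
  have hsum : ∑ d ∈ B, ((slopeSet f d).card - 1) = Fintype.card F - 1 := by
    rw [sum_card_slopeSet_sub_one hf0, Finset.filter_true_of_mem,
      Finset.card_erase_of_mem (by simp), Finset.card_univ]
    intro x hx
    have hx0 := Finset.ne_of_mem_erase hx
    by_contra hxB
    refine hx0 (hB' _ hxB ?_)
    simp [hf0, mul_div_cancel₀ _ hx0]
  have hBne : B.Nonempty := by
    by_contra h
    rw [Finset.not_nonempty_iff_eq_empty] at h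
    have : 1 < Fintype.card F := Fintype.one_lt_card
    rw [h, Finset.sum_empty] at hsum
    omega
  obtain ⟨d₀, hd₀, hmin⟩ := Finset.exists_min_image B (fun d => (slopeSet f d).card) hBne
  obtain ⟨s, hs⟩ : ∃ s, (slopeSet f d₀).card = s := ⟨_, rfl⟩
  simp only [hs] at hmin
  have h2 : 2 ≤ s := by
    have h1 := hpos d₀
    have h1' := mt (hnotmem d₀).mpr (not_not.mpr hd₀)
    omega
  rcases (Finset.card_le_univ (slopeSet f d₀)).eq_or_lt with heq | hlt
  · have hlin : ∀ x, f x = x * d₀ := fun x => mem_slopeSet.mp <| by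
      rw [Finset.card_eq_iff_eq_univ] at heq
      simp [heq]
    rw [hlin, hlin, hlin]; ring
  rw [hs] at hlt
  have hsubs := sum_card_slopeSet_sub_lt hB' hs h2 hlt
  have hsN : Fintype.card F + s ≤ s * B.card := by
    have h1 : ∑ d ∈ B, ((slopeSet f d).card - 1) =
        ∑ d ∈ B, ((slopeSet f d).card - s) + B.card * (s - 1) := by
      rw [← smul_eq_mul, ← Finset.sum_const, ← Finset.sum_add_distrib]
      refine Finset.sum_congr rfl fun d hd => ?_
      have := hmin d hd
      omega
    have h4 := Finset.card_le_univ B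
    obtain ⟨m, rfl⟩ : ∃ m, s = m + 1 := ⟨s - 1, by omega⟩
    rw [Nat.add_sub_cancel] at h1
    rw [add_mul, one_mul, mul_comm m]
    omega
  have h3 : 3 ≤ s := by
    by_contra h
    obtain rfl : s = 2 := by omega
    omega
  obtain ⟨l, hl0, hl1, hl⟩ := exists_pow_eq_one hB' hmin hs h3 hlt.le hf0
  refine map_add_of_polynomial_inverse hf0 hf hP hl0 hl1 (fun u => ?_) v w
  set S := B.filter fun d => (slopeSet f d).card = s with hS
  have hSbound : Fintype.card F ≤ 2 * ((s - 1) * S.card) := by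
    obtain ⟨g, hg, hgap⟩ := exists_gap_of_dvd h3 (hs ▸ card_slopeSet_dvd hf0 hfib d₀)
    refine le_two_mul_of_gap (M := (B.filter fun d => ¬ (slopeSet f d).card = s).card)
      (g := g) (by omega) hg ?_ ?_
    · rw [Finset.card_filter_add_card_filter_not]
      exact hsN
    · rw [← hsum, ← Finset.sum_filter_add_sum_filter_not B fun d => (slopeSet f d).card = s]
      refine add_le_add ?_ ?_
      · rw [← smul_eq_mul, ← Finset.sum_const]
        refine Finset.sum_le_sum fun d hd => ?_
        rw [(Finset.mem_filter.mp hd).2]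
      · rw [← smul_eq_mul, ← Finset.sum_const]
        refine Finset.sum_le_sum fun d hd => ?_
        obtain ⟨hdB, hne⟩ := Finset.mem_filter.mp hd
        have := hgap _ (card_slopeSet_dvd hf0 hfib d) (lt_of_le_of_ne (hmin d hdB) (Ne.symm hne))
        omega
  have htr := card_slopeSet_translate hf0 hfib u
  have hSsum : (s - 1) * S.card =
      ((Finset.univ.erase 0).filter fun x => (f (x + u) - f u) / x ∈ S).card := by
    rw [← sum_card_slopeSet_sub_one (g := fun x => f (x + u) - f u) (by simp),
      Finset.sum_congr rfl (g := fun _ => s - 1), Finset.sum_const, smul_eq_mul, mul_comm]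
    intro d hd
    rw [htr, (Finset.mem_filter.mp hd).2]
  have hsubset : insert 0 ((Finset.univ.erase 0).filter fun x => (f (x + u) - f u) / x ∈ S) ⊆
      Finset.univ.filter fun x => f (l * x + u) - f u = l * (f (x + u) - f u) := by
    intro x hx
    rw [Finset.mem_filter]
    refine ⟨Finset.mem_univ _, ?_⟩
    rcases Finset.mem_insert.mp hx with rfl | hx
    · simp
    · rw [Finset.mem_filter, Finset.mem_erase] at hx
      have hd := (Finset.mem_filter.mp hx.2).2
      refine apply_mul_of_mem_slopeSet (g := fun x => f (x + u) - f u) (B := B) (fun y hy => ?_)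
        (fun d hd => by rw [htr]; exact hmin d hd) (by rw [htr, hd]) h2 hlt.le (by simp) hl
        (mem_slopeSet.mpr (mul_div_cancel₀ _ hx.1.1).symm)
      intro a b hab
      have := hB' y hy (a₁ := a + u) (a₂ := b + u) (by
        simp only at hab ⊢
        linear_combination hab)
      simpa using this
  have hle := Finset.card_le_card hsubset
  rw [Finset.card_insert_of_notMem (by simp), ← hSsum] at hle
  omega

end Additive

/-- A function whose directions lie in a small set avoiding zero is additive. -/
lemma map_add_of_directions_mem {f : F → F} (hf0 : f 0 = 0) {E : Set F} (h0 : (0 : F) ∉ E)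
    (hE : ∀ x y, x ≠ y → (f x - f y) / (x - y) ∈ E)
    (hcard : 2 * E.ncard ≤ Fintype.card F + 1) (v w : F) : f (v + w) = f v + f w := by
  classical
  have hf : Function.Injective f := by
    intro x y hxy
    by_contra hne
    have := hE x y hne
    rw [hxy, sub_self, zero_div] at this
    exact h0 this
  refine map_add_of_card_directions_le hf0 hf
    (B := Finset.univ.filter fun y => ¬ Function.Injective fun x => f x - x * y) (by simp) ?_ v w
  refine le_trans (Nat.mul_le_mul_left 2 ?_) hcard
  rw [← Set.ncard_coe_finset]
  refine Set.ncard_le_ncard (fun d hd => ?_) (Set.toFinite E)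
  obtain ⟨x, y, hxy, hne⟩ : ∃ x y, f x - x * d = f y - y * d ∧ x ≠ y := by
    simpa [Function.Injective] using hd
  have hd' : d = (f x - f y) / (x - y) := by
    rw [eq_div_iff (sub_ne_zero.mpr hne)]
    linear_combination -hxy
  exact hd' ▸ hE x y hne

omit [Fintype F] in
lemma inv_add_inv_inv_sub {x y : F} (hx : x ≠ 0) (hy : y ≠ 0) (hxy : y⁻¹ - x ≠ 0) :
    (x⁻¹ + (y⁻¹ - x)⁻¹)⁻¹ = x - x ^ 2 * y := by
  have h1 : 1 - x * y ≠ 0 := fun h => hxy (by field_simp; linear_combination h)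
  have h2 : y⁻¹ - x = (1 - x * y) / y := by field_simp
  have h3 : x⁻¹ + (y⁻¹ - x)⁻¹ = (x * (1 - x * y))⁻¹ := by
    rw [h2]; field_simp; ring
  rw [h3, inv_inv]; ring

/-- A form of Hua's theorem: an additive map that is compatible with inversion up to an additive
map is multiplicative. -/
lemma map_mul_of_additive_inv {g G : F → F} (hg : ∀ x y, g (x + y) = g x + g y)
    (hG : ∀ x y, G (x + y) = G x + G y) (hgG : ∀ x, G x = (g x⁻¹)⁻¹) (h1 : g 1 = 1)
    (hinj : Function.Injective g) (x y : F) : g (x * y) = g x * g y := by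
  let φ : F →+ F := AddMonoidHom.mk' g hg
  have hsub : ∀ x y, g (x - y) = g x - g y := φ.map_sub
  have hg0 : g 0 = 0 := φ.map_zero
  have hne : ∀ {x}, x ≠ 0 → g x ≠ 0 := fun hx h => hx (hinj (h.trans hg0.symm))
  have hginv : ∀ x, g x⁻¹ = (G x)⁻¹ := fun x => by rw [hgG, inv_inv]
  have hquad : ∀ x y, g (x ^ 2 * y) = g x ^ 2 * G y := by
    intro x y
    by_cases hx : x = 0
    · simp [hx, hg0]
    by_cases hy : y = 0
    · simp [hy, hg0, hgG]
    by_cases hxy : y⁻¹ - x = 0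
    · obtain rfl : x = y⁻¹ := (sub_eq_zero.mp hxy).symm
      have := hne hx
      rw [hgG, pow_two, mul_assoc, inv_mul_cancel₀ hy, mul_one]
      field_simp
    · have hb : G y ≠ 0 := by rw [hgG]; exact inv_ne_zero (hne (inv_ne_zero hy))
      have hbx : (G y)⁻¹ - g x ≠ 0 := by
        rw [← hginv, ← hsub]; exact hne hxy
      have key : g (x - x ^ 2 * y) = g x - g x ^ 2 * G y := by
        rw [← inv_add_inv_inv_sub hx hy hxy, hginv, hG, ← inv_add_inv_inv_sub (hne hx) hb hbx,
          hgG x⁻¹, inv_inv, hgG (y⁻¹ - x)⁻¹, inv_inv, hsub, hginv]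
      rw [hsub] at key
      linear_combination -key
  have hGg : ∀ y, G y = g y := fun y => by simpa [h1] using (hquad 1 y).symm
  have hsq : ∀ x y, g (x ^ 2 * y) = g (x ^ 2) * g y := by
    intro x y
    have := hquad x 1
    rw [mul_one, hGg, h1, mul_one] at this
    rw [hquad, hGg, this]
  by_cases h2 : ringChar F = 2
  · obtain ⟨r, rfl⟩ := FiniteField.isSquare_of_char_two h2 x
    rw [← pow_two, hsq]
  · have h2' : (2 : F) ≠ 0 := Ring.two_ne_zero h2
    obtain ⟨a, b, rfl⟩ : ∃ a b : F, x = a ^ 2 - b ^ 2 :=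
      ⟨(x + 1) / 2, (x - 1) / 2, by field_simp; ring⟩
    rw [sub_mul, hsub, hsub, hsq, hsq, sub_mul]

/-- The homomorphism `u ↦ σ u / u` on units. -/
def unitsQuotient (σ : F →+* F) : Fˣ →* Fˣ := Units.map (σ : F →* F) / MonoidHom.id Fˣ

omit [Fintype F] in
lemma coe_unitsQuotient (σ : F →+* F) (u : Fˣ) : (unitsQuotient σ u : F) = σ u / u := by
  simp [unitsQuotient]

omit [Fintype F] in
lemma mem_ker_unitsQuotient {σ : F →+* F} {u : Fˣ} : u ∈ (unitsQuotient σ).ker ↔ σ u = u := by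
  rw [MonoidHom.mem_ker, Units.ext_iff, coe_unitsQuotient, Units.val_one,
    div_eq_one_iff_eq u.ne_zero]

omit [Fintype F] in
lemma card_ker_unitsQuotient (σ : F →+* F) :
    Nat.card (unitsQuotient σ).ker = Nat.card (σ.eqLocusField (RingHom.id F)) - 1 := by
  rw [← Nat.card_units]
  exact Nat.card_congr
    { toFun := fun u => Units.mk0 ⟨(u : Fˣ), mem_ker_unitsQuotient.mp u.2⟩
        fun h => (u : Fˣ).ne_zero (congrArg Subtype.val h)
      invFun := fun v => ⟨Units.map (σ.eqLocusField (RingHom.id F)).subtype v,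
        by rw [mem_ker_unitsQuotient]; exact (v : σ.eqLocusField (RingHom.id F)).2⟩
      left_inv := fun u => by ext; rfl
      right_inv := fun v => by ext; rfl }

lemma exists_card_subfield_eq_pow {p n : ℕ} (hp : p.Prime) (hF : Fintype.card F = p ^ n)
    (L : Subfield F) : ∃ r, r ∣ n ∧ Nat.card L = p ^ r := by
  have h := Module.natCard_eq_pow_finrank (K := L) (V := F)
  rw [Nat.card_eq_fintype_card, hF] at h
  have hpos : Module.finrank L F ≠ 0 := Module.finrank_pos.ne'
  obtain ⟨r, -, hr⟩ := (Nat.dvd_prime_pow hp).mp (h ▸ dvd_pow_self (Nat.card L) hpos)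
  rw [hr, ← pow_mul] at h
  exact ⟨r, ⟨_, Nat.pow_right_injective hp.two_le h⟩, hr⟩

end Redei

theorem stmt_9 {p n : ℕ} (hp : p.Prime) (hn : 0 < n)
    {F : Type*} [Field F] [Fintype F] (hF : Fintype.card F = p ^ n)
    (D : Set F) (hD : D ⊆ {0}ᶜ)
    (hcard : (D * D⁻¹ * D⁻¹).ncard ≤ (p ^ n + 1) / 2)
    (f : F → F) (hf0 : f 0 = 0)
    (hdir : {d : F | ∃ x y : F, x ≠ y ∧ d = (f x - f y) / (x - y)} = D) :
    ∃ a : F, a ≠ 0 ∧ ∃ r : ℕ, r ∣ n ∧ ∃ K : Subgroup Fˣ,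
      K.index = p ^ r - 1 ∧
      D = (fun u : Fˣ => a * (u : F)) '' (K : Set Fˣ) := by
  have hmem : ∀ x y, x ≠ y → (f x - f y) / (x - y) ∈ D := fun x y hxy => hdir ▸ ⟨x, y, hxy, rfl⟩
  have hmem0 : ∀ x, x ≠ 0 → f x / x ∈ D := fun x hx => by simpa [hf0] using hmem x 0 hx
  have hDne : ∀ d ∈ D, d ≠ 0 := fun d hd => hD hd
  have hfne : ∀ x, x ≠ 0 → f x ≠ 0 := fun x hx h => hDne _ (hmem0 x hx) (by simp [h])
  have hEmem : ∀ a ∈ D, ∀ b ∈ D, ∀ c ∈ D, a * b⁻¹ * c⁻¹ ∈ D * D⁻¹ * D⁻¹ := fun a ha b hb c hc =>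
    Set.mul_mem_mul (Set.mul_mem_mul ha (Set.inv_mem_inv.mpr hb)) (Set.inv_mem_inv.mpr hc)
  have hE0 : (0 : F) ∉ D * D⁻¹ * D⁻¹ := by
    rintro ⟨_, ⟨a, ha, b, hb, rfl⟩, c, hc, h⟩
    have hb' := hDne _ (Set.mem_inv.mp hb)
    have hc' := hDne _ (Set.mem_inv.mp hc)
    exact mul_ne_zero (mul_ne_zero (hDne a ha) (by simpa using hb')) (by simpa using hc') h
  have hEcard : 2 * (D * D⁻¹ * D⁻¹).ncard ≤ Fintype.card F + 1 := by rw [hF]; omega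
  have hDcard : D.ncard ≤ (D * D⁻¹ * D⁻¹).ncard := by
    have h1 := hmem0 1 one_ne_zero
    refine Set.ncard_le_ncard_of_injOn (fun d => d * (f 1 / 1)⁻¹ * (f 1 / 1)⁻¹)
      (fun d hd => hEmem d hd _ h1 _ h1) (fun x _ y _ h => ?_) (Set.toFinite _)
    have h2 := inv_ne_zero (hDne _ h1)
    exact mul_right_cancel₀ h2 (mul_right_cancel₀ h2 h)
  have hfadd := Redei.map_add_of_directions_mem hf0 (fun h => hDne 0 h rfl) hmem (by omega)
  have hinvadd := Redei.map_add_of_directions_mem (f := fun x => (f x⁻¹)⁻¹) (by simp [hf0]) hE0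
    (fun x y hxy => by
      have hzero : ∀ z, z ≠ 0 → (f z⁻¹)⁻¹ / z ∈ D * D⁻¹ * D⁻¹ := by
        intro z hz
        have h1 := hmem0 z⁻¹ (inv_ne_zero hz)
        have h2 := hfne z⁻¹ (inv_ne_zero hz)
        convert hEmem _ h1 _ h1 _ h1 using 1
        field_simp
      by_cases hx : x = 0
      · have hy : y ≠ 0 := fun h => hxy (hx.trans h.symm)
        simpa [hx, hf0] using hzero y hy
      by_cases hy : y = 0
      · simpa [hy, hf0] using hzero x hx
      have hne : x⁻¹ ≠ y⁻¹ := fun h => hxy (inv_injective h)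
      convert hEmem _ (hmem _ _ hne) _ (hmem0 _ (inv_ne_zero hx)) _ (hmem0 _ (inv_ne_zero hy))
        using 1
      have h1 := hfne _ (inv_ne_zero hx)
      have h2 := hfne _ (inv_ne_zero hy)
      have h3 := sub_ne_zero.mpr hxy
      have h4 := sub_ne_zero.mpr hxy.symm
      have h5 : x⁻¹ - y⁻¹ = (y - x) / (x * y) := by field_simp
      rw [h5]
      generalize f x⁻¹ = c at h1 ⊢
      generalize f y⁻¹ = e at h2 ⊢
      field_simp
      ring) hEcard
  have ha := hfne 1 one_ne_zero
  have hinj : Function.Injective f := by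
    intro x y hxy
    by_contra hne
    exact hDne _ (hmem x y hne) (by simp [hxy])
  have hmul := Redei.map_mul_of_additive_inv (g := fun x => f x / f 1)
    (G := fun x => f 1 * (f x⁻¹)⁻¹) (fun x y => by rw [hfadd, add_div])
    (fun x y => by rw [hinvadd x y, mul_add]) (fun x => by rw [inv_div, div_eq_mul_inv])
    (div_self ha) fun x y h => hinj (by simpa [ha] using h)
  let σ : F →+* F :=
    { toFun := fun x => f x / f 1
      map_zero' := by simp [hf0]
      map_one' := div_self ha
      map_add' := fun x y => by rw [hfadd, add_div]
      map_mul' := hmul }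
  have hfσ : ∀ x, f x = f 1 * σ x := fun x => (mul_div_cancel₀ (f x) ha).symm
  obtain ⟨r, hrn, hr⟩ := Redei.exists_card_subfield_eq_pow hp hF (σ.eqLocusField (RingHom.id F))
  refine ⟨f 1, ha, r, hrn, (Redei.unitsQuotient σ).range, ?_, ?_⟩
  · rw [Subgroup.index_range, Redei.card_ker_unitsQuotient, hr]
  · rw [← hdir]
    ext d
    simp only [Set.mem_ofPred_eq, Set.mem_image, SetLike.mem_coe, MonoidHom.mem_range,
      exists_exists_eq_and, Redei.coe_unitsQuotient]
    constructor
    · rintro ⟨x, y, hxy, rfl⟩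
      refine ⟨Units.mk0 (x - y) (sub_ne_zero.mpr hxy), ?_⟩
      rw [hfσ x, hfσ y, Units.val_mk0, map_sub]
      ring
    · rintro ⟨u, rfl⟩
      refine ⟨u, 0, u.ne_zero, ?_⟩
      rw [hf0, hfσ u]
      ring
end

section
/- Let p be a prime, q = p^n, and let K be a proper subgroup of 𝔽_q* (so K ≠ 𝔽_q*). Then |K K⁻¹ K⁻¹| = |K| ≤ (q-1)/2 ≤ (q+1)/2; consequently, the main theorem applied with D = K recovers McConnel's theorem: if f : 𝔽_q → 𝔽_q satisfies (f(x)-f(y))/(x-y) ∈ K for all x ≠ y, then f(x) = a x^(p^j) + b for some a, b ∈ 𝔽_q and 0 ≤ j ≤ n-1. -/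
open Pointwise

section Digits

variable {p : ℕ}

theorem Nat.Prime.not_dvd_choose_of_digit (hp : p.Prime) {m i : ℕ} (h : i % p ≤ m % p)
    (h' : ¬ p ∣ (m / p).choose (i / p)) : ¬ p ∣ m.choose i := by
  have := Fact.mk hp
  rw [(Choose.choose_modEq_choose_mod_mul_choose_div_nat (n := m) (k := i) (p := p)).dvd_iff
    dvd_rfl, hp.dvd_mul, not_or]
  refine ⟨fun hd => ?_, h'⟩
  have hd' : p ∣ (m % p).factorial := by
    rw [← Nat.choose_mul_factorial_mul_factorial h, mul_assoc]
    exact hd.mul_right _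
  exact (Nat.mod_lt m hp.pos).not_ge (hp.dvd_factorial.1 hd')

theorem Nat.Prime.not_dvd_choose_mod_add (hp : p.Prime) (k : ℕ) {m j : ℕ}
    (hj : j ≤ m / p ^ k % p) : ¬ p ∣ m.choose (m % p ^ k + p ^ k * j) := by
  have hlt : ∀ a, a % p < p := fun a => Nat.mod_lt a hp.pos
  induction k generalizing m with
  | zero =>
    simp only [pow_zero, Nat.div_one] at hj
    have hjp : j < p := hj.trans_lt (hlt m)
    apply hp.not_dvd_choose_of_digit
    · simpa [Nat.mod_one, Nat.mod_eq_of_lt hjp] using hj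
    · simpa [Nat.mod_one, Nat.div_eq_of_lt hjp] using hp.one_lt.ne'
  | succ k ih =>
    have hi : m % p ^ (k + 1) + p ^ (k + 1) * j =
        m % p + p * ((m / p) % p ^ k + p ^ k * j) := by
      rw [pow_succ', Nat.mod_mul]; ring
    rw [hi]
    apply hp.not_dvd_choose_of_digit
    · simp
    · rw [Nat.add_mul_div_left _ _ hp.pos, Nat.div_eq_of_lt (hlt m), zero_add]
      apply ih
      rwa [Nat.div_div_eq_div_mul, ← pow_succ']

theorem Nat.Prime.not_dvd_choose_pow_of_digit_ne_zero (hp : p.Prime) (k : ℕ) {m : ℕ}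
    (hj : m / p ^ k % p ≠ 0) : ¬ p ∣ m.choose (p ^ k) := by
  induction k generalizing m with
  | zero =>
    simp only [pow_zero, Nat.div_one] at hj
    rw [pow_zero, Nat.choose_one_right]
    rwa [Nat.dvd_iff_mod_eq_zero]
  | succ k ih =>
    apply hp.not_dvd_choose_of_digit
    · simp [pow_succ']
    · rw [pow_succ', Nat.mul_div_cancel_left _ hp.pos]
      apply ih
      rwa [Nat.div_div_eq_div_mul, ← pow_succ']

theorem Nat.mod_pow_eq_sum_digits (p m k : ℕ) :
    m % p ^ k = ∑ i ∈ Finset.range k, (m / p ^ i % p) * p ^ i := by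
  induction k with
  | zero => simp [Nat.mod_one]
  | succ k ih => rw [Nat.mod_pow_succ, Finset.sum_range_succ, ih, mul_comm]

/-- The cyclic rotation by `k` places of the `n`-digit base `p` expansion of `j`. -/
def digitRotate (p n k j : ℕ) : ℕ := p ^ k * (j % p ^ (n - k)) + j / p ^ (n - k)

variable {n k : ℕ}

theorem div_pow_sub_lt (hk : k ≤ n) {j : ℕ} (hj : j < p ^ n) : j / p ^ (n - k) < p ^ k := by
  apply Nat.div_lt_of_lt_mul
  rwa [← pow_add, Nat.sub_add_cancel hk]

theorem digitRotate_lt (hp : 0 < p) (hk : k ≤ n) {j : ℕ} (hj : j < p ^ n) :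
    digitRotate p n k j < p ^ n := by
  have h1 := div_pow_sub_lt hk hj
  have h2 : j % p ^ (n - k) + 1 ≤ p ^ (n - k) := Nat.mod_lt _ (by positivity)
  calc digitRotate p n k j < p ^ k * (j % p ^ (n - k) + 1) := by
        unfold digitRotate; rw [mul_add, mul_one]; omega
    _ ≤ p ^ k * p ^ (n - k) := Nat.mul_le_mul_left _ h2
    _ = p ^ n := by rw [← pow_add, Nat.add_sub_cancel' hk]

theorem digitRotate_injOn (hp : 0 < p) (hk : k ≤ n) {i j : ℕ} (hi : i < p ^ n) (hj : j < p ^ n)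
    (h : digitRotate p n k i = digitRotate p n k j) : i = j := by
  have hi' := div_pow_sub_lt hk hi
  have hj' := div_pow_sub_lt hk hj
  have hpk : 0 < p ^ k := by positivity
  unfold digitRotate at h
  have hdiv := congrArg (· / p ^ k) h
  have hmod := congrArg (· % p ^ k) h
  simp only [Nat.mul_add_div hpk, Nat.div_eq_of_lt hi', Nat.div_eq_of_lt hj', add_zero] at hdiv
  simp only [Nat.mul_add_mod, Nat.mod_eq_of_lt hi', Nat.mod_eq_of_lt hj'] at hmod
  rw [← Nat.mod_add_div i (p ^ (n - k)), ← Nat.mod_add_div j (p ^ (n - k)), hdiv, hmod]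

/-- The leading digit of `j` bounds every rotation of `j` from below, with equality only if it is
the only digit and equal to one. -/
theorem pow_le_digitRotate (hp : p.Prime) (hk : k < n) {j : ℕ} (hj0 : j ≠ 0) (hj : j < p ^ n) :
    p ^ ((k + Nat.log p j) % n) ≤ digitRotate p n k j ∧
      (digitRotate p n k j ≤ p ^ ((k + Nat.log p j) % n) → j = p ^ Nat.log p j) := by
  set s := Nat.log p j with hs
  have hsj : p ^ s ≤ j := Nat.pow_log_le_self p hj0
  have hjs : j < p ^ (s + 1) := Nat.lt_pow_succ_log_self hp.one_lt j
  have hsn : s < n := by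
    by_contra! h
    exact (hj.trans_le (Nat.pow_le_pow_right hp.pos h)).not_ge hsj
  have hpk : 0 < p ^ k := pow_pos hp.pos k
  unfold digitRotate
  rcases lt_or_ge (k + s) n with h | h
  · have hjl : j < p ^ (n - k) := hjs.trans_le (Nat.pow_le_pow_right hp.pos (by omega))
    rw [Nat.mod_eq_of_lt h, Nat.mod_eq_of_lt hjl, Nat.div_eq_of_lt hjl, add_zero, pow_add]
    exact ⟨Nat.mul_le_mul_left _ hsj, fun h' => le_antisymm (Nat.le_of_mul_le_mul_left h' hpk) hsj⟩
  · have hmod : (k + s) % n = k + s - n := by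
      rw [Nat.mod_eq_sub_mod h, Nat.mod_eq_of_lt (by omega)]
    have hsplit : p ^ s = p ^ (n - k) * p ^ (k + s - n) := by
      rw [← pow_add]; congr 1; omega
    have hle : p ^ (k + s - n) ≤ j / p ^ (n - k) := by
      rw [Nat.le_div_iff_mul_le (pow_pos hp.pos _), mul_comm, ← hsplit]
      exact hsj
    rw [hmod]
    refine ⟨by omega, fun h' => ?_⟩
    have h0 : p ^ k * (j % p ^ (n - k)) = 0 := by omega
    have h1 : j % p ^ (n - k) = 0 := by
      rcases Nat.mul_eq_zero.1 h0 with h | h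
      · omega
      · exact h
    have h2 : j / p ^ (n - k) = p ^ (k + s - n) := by omega
    rw [hsplit, ← h2, Nat.mul_div_cancel' (Nat.dvd_of_mod_eq_zero h1)]

/-- A positive divisor `m` of `p ^ n - 1` is minimal among the rotations of its digits. -/
theorem le_sum_digits_rotate (hp : p.Prime) {m : ℕ} (hm : 0 < m) (hmn : m < p ^ n)
    (hdvd : m ∣ p ^ n - 1) (s : ℕ) :
    m ≤ ∑ k ∈ Finset.range n, (m / p ^ k % p) * p ^ ((k + s) % n) := by
  have hq : p ^ n ≡ 1 [MOD m] := ((Nat.modEq_iff_dvd' (pow_pos hp.pos n)).2 hdvd).symm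
  have hpow : ∀ t, p ^ (t % n) ≡ p ^ t [MOD m] := fun t => by
    conv_rhs => rw [← Nat.mod_add_div t n, pow_add, pow_mul]
    simpa using ((hq.pow (t / n)).mul_left (p ^ (t % n))).symm
  have hsum : m = ∑ k ∈ Finset.range n, (m / p ^ k % p) * p ^ k := by
    rw [← Nat.mod_pow_eq_sum_digits, Nat.mod_eq_of_lt hmn]
  apply Nat.le_of_dvd
  · by_contra! h0
    have h0' := (Finset.sum_eq_zero_iff).1 (Nat.le_zero.1 h0)
    apply hm.ne'
    rw [hsum]
    refine Finset.sum_eq_zero fun k hk => ?_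
    rcases Nat.mul_eq_zero.1 (h0' k hk) with h | h
    · rw [h, zero_mul]
    · exact absurd h (pow_pos hp.pos _).ne'
  · have : ∑ k ∈ Finset.range n, (m / p ^ k % p) * p ^ ((k + s) % n) ≡ m * p ^ s [MOD m] := by
      conv_rhs => rw [hsum, Finset.sum_mul]
      refine Nat.ModEq.sum fun k _ => ?_
      rw [mul_assoc, ← pow_add]
      exact (hpow (k + s)).mul_left _
    rw [this.dvd_iff dvd_rfl]
    exact dvd_mul_right m _

end Digits

section Interpolation

open Polynomial

variable {F : Type*} [Field F] [Fintype F]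

open Classical in
/-- The polynomial of degree less than `Fintype.card F` representing a function on `F`. -/
noncomputable def functionPoly : (F → F) →ₗ[F] F[X] := Lagrange.interpolate Finset.univ id

theorem functionPoly_eval (g : F → F) (x : F) : (functionPoly g).eval x = g x := by
  classical
  exact Lagrange.eval_interpolate_at_node g Function.injective_id.injOn (Finset.mem_univ x)

theorem functionPoly_degree_lt (g : F → F) : (functionPoly g).degree < Fintype.card F := by
  classical
  exact Lagrange.degree_interpolate_lt g Function.injective_id.injOn

theorem lt_card_of_mem_support_functionPoly {g : F → F} {i : ℕ}
    (hi : i ∈ (functionPoly g).support) : i < Fintype.card F := by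
  exact_mod_cast (le_degree_of_mem_supp i hi).trans_lt (functionPoly_degree_lt g)

theorem functionPoly_eq {g : F → F} {P : F[X]} (hP : P.degree < Fintype.card F)
    (h : ∀ x, P.eval x = g x) : functionPoly g = P := by
  classical
  exact (Lagrange.eq_interpolate_of_eval_eq g Function.injective_id.injOn hP
    fun x _ => h x).symm

theorem functionPoly_ne_zero {g : F → F} (hg : g ≠ 0) : functionPoly g ≠ 0 := fun h =>
  hg (funext fun x => by rw [← functionPoly_eval g x, h, eval_zero, Pi.zero_apply])

theorem natDegree_functionPoly_mul {g h : F → F} (hg : g ≠ 0) (hh : h ≠ 0)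
    (hdeg : (functionPoly g).natDegree + (functionPoly h).natDegree < Fintype.card F) :
    (functionPoly (g * h)).natDegree =
      (functionPoly g).natDegree + (functionPoly h).natDegree := by
  rw [← natDegree_mul (functionPoly_ne_zero hg) (functionPoly_ne_zero hh)] at hdeg ⊢
  rw [functionPoly_eq (P := functionPoly g * functionPoly h)]
  · exact (natDegree_lt_iff_degree_lt
      (mul_ne_zero (functionPoly_ne_zero hg) (functionPoly_ne_zero hh))).1 hdeg
  · intro x
    rw [eval_mul, functionPoly_eval, functionPoly_eval, Pi.mul_apply]

theorem natDegree_functionPoly_pow_le {m : ℕ} (hm : m < Fintype.card F) {f : F → F}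
    (hf : ∀ x y, (f x - f y) ^ m = (x - y) ^ m) (hsurj : Function.Surjective f)
    {i : ℕ} (hi : (m.choose i : F) ≠ 0) : (functionPoly (f ^ i)).natDegree ≤ m := by
  rw [natDegree_le_iff_coeff_eq_zero]
  intro N hN
  have him : i ≤ m := by
    by_contra! h
    exact hi (by rw [Nat.choose_eq_zero_of_lt h, Nat.cast_zero])
  let Q : F[X] := ∑ j ∈ Finset.range (m + 1),
    C ((m.choose j : F) * (functionPoly (f ^ j)).coeff N) * X ^ (m - j)
  have hQ : Q = 0 := by
    refine eq_zero_of_degree_lt_of_eval_finset_eq_zero Finset.univ ?_ fun y _ => ?_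
    · rw [Finset.card_univ]
      refine (degree_sum_le _ _).trans_lt ((Finset.sup_lt_iff ?_).2 fun j _ => ?_)
      · exact WithBot.bot_lt_coe _
      · refine (degree_C_mul_X_pow_le _ _).trans_lt ?_
        exact_mod_cast (Nat.sub_le m j).trans_lt hm
    · obtain ⟨c, hc⟩ := hsurj (-y)
      have hdeg : ((X - C c) ^ m).natDegree = m := by
        rw [natDegree_pow, natDegree_X_sub_C, mul_one]
      have h1 : functionPoly (∑ j ∈ Finset.range (m + 1), (y ^ (m - j) * m.choose j) • f ^ j) =
          (X - C c) ^ m := by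
        apply functionPoly_eq
        · rw [← natDegree_lt_iff_degree_lt (pow_ne_zero _ (X_sub_C_ne_zero c)), hdeg]
          exact hm
        · intro x
          rw [eval_pow, eval_sub, eval_X, eval_C, ← hf, hc, sub_neg_eq_add, add_pow,
            Finset.sum_apply]
          refine Finset.sum_congr rfl fun j _ => ?_
          rw [Pi.smul_apply, Pi.pow_apply, smul_eq_mul]
          ring
      have h2 := congrArg (fun P => coeff P N) h1
      simp only [map_sum, map_smul, finsetSum_coeff, coeff_smul, smul_eq_mul] at h2
      rw [coeff_eq_zero_of_natDegree_lt (hdeg.trans_lt hN)] at h2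
      rw [eval_finsetSum, ← h2]
      refine Finset.sum_congr rfl fun j _ => ?_
      rw [eval_mul, eval_C, eval_pow, eval_X]
      ring
  have hcoeff : Q.coeff (m - i) = (m.choose i : F) * (functionPoly (f ^ i)).coeff N := by
    simp only [Q, finsetSum_coeff, coeff_C_mul_X_pow]
    rw [Finset.sum_eq_single i]
    · simp
    · intro j hj hji
      rw [if_neg]
      have := Finset.mem_range.1 hj
      omega
    · intro h
      exact absurd (Finset.mem_range.2 (by omega)) h
  rw [hQ, coeff_zero] at hcoeff
  exact (mul_eq_zero.1 hcoeff.symm).resolve_left hi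

theorem digitRotate_le_natDegree {p n k : ℕ} (hp : p.Prime) [CharP F p]
    (hF : Fintype.card F = p ^ n) (hk : k ≤ n) (f : F → F) {j : ℕ}
    (hj : (functionPoly f).coeff j ≠ 0) :
    digitRotate p n k j ≤ (functionPoly (f ^ p ^ k)).natDegree := by
  have := Fact.mk hp
  set P := functionPoly f with hP
  have hlt : ∀ i ∈ P.support, i < p ^ n := fun i hi => hF ▸ lt_card_of_mem_support_functionPoly hi
  have hj' : j ∈ P.support := mem_support_iff.2 hj
  let R : F[X] := ∑ i ∈ P.support, C (P.coeff i ^ p ^ k) * X ^ digitRotate p n k i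
  have hR : functionPoly (f ^ p ^ k) = R := by
    apply functionPoly_eq
    · refine (degree_sum_le _ _).trans_lt ((Finset.sup_lt_iff ?_).2 fun i hi => ?_)
      · exact WithBot.bot_lt_coe _
      · refine (degree_C_mul_X_pow_le _ _).trans_lt ?_
        rw [hF]
        exact_mod_cast digitRotate_lt hp.pos hk (hlt i hi)
    · intro x
      rw [Pi.pow_apply, ← functionPoly_eval f x, ← hP, eval_eq_sum (p := P),
        Polynomial.sum, sum_pow_char_pow, eval_finsetSum]
      refine Finset.sum_congr rfl fun i _ => ?_
      rw [eval_mul, eval_C, eval_pow, eval_X, mul_pow, ← pow_mul]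
      congr 1
      have hi : i * p ^ k = p ^ k * (i % p ^ (n - k)) + p ^ n * (i / p ^ (n - k)) := by
        have h1 : p ^ n = p ^ k * p ^ (n - k) := by rw [← pow_add, Nat.add_sub_cancel' hk]
        rw [h1, mul_assoc, ← mul_add, Nat.mod_add_div, mul_comm]
      rw [hi, digitRotate, pow_add, pow_add, pow_mul x (p ^ n), ← hF, FiniteField.pow_card]
  rw [hR]
  apply le_natDegree_of_ne_zero
  have : R.coeff (digitRotate p n k j) = P.coeff j ^ p ^ k := by
    simp only [R, finsetSum_coeff, coeff_C_mul_X_pow]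
    rw [Finset.sum_eq_single j]
    · simp
    · intro i hi hij
      rw [if_neg]
      exact fun h => hij (digitRotate_injOn hp.pos hk (hlt j hj') (hlt i hi) h).symm
    · exact fun h => absurd hj' h
  rw [this]
  exact pow_ne_zero _ hj

theorem sum_digits_mul_natDegree {p n m : ℕ} (hp : p.Prime) [CharP F p]
    (hF : Fintype.card F = p ^ n) (hm : 2 * m < p ^ n) {f : F → F} (hf0 : f 0 = 0)
    (hf : ∀ x y, (f x - f y) ^ m = (x - y) ^ m) (hinj : Function.Injective f) :
    ∑ k ∈ Finset.range n, (m / p ^ k % p) * (functionPoly (f ^ p ^ k)).natDegree = m := by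
  have hsurj := Finite.surjective_of_injective hinj
  have hdeg : ∀ i, ¬ p ∣ m.choose i → (functionPoly (f ^ i)).natDegree ≤ m := fun i hi =>
    natDegree_functionPoly_pow_le (by omega) hf hsurj (by rwa [Ne, CharP.cast_eq_zero_iff F p])
  have hne : ∀ i, f ^ i ≠ 0 := fun i h => by
    have h1 : f 1 ≠ 0 := fun h => one_ne_zero (hinj (h.trans hf0.symm))
    exact pow_ne_zero i h1 (congrFun h 1)
  have hstep : ∀ k j, j ≤ m / p ^ k % p →
      (functionPoly (f ^ (m % p ^ k + p ^ k * j))).natDegree =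
        (functionPoly (f ^ (m % p ^ k))).natDegree +
          j * (functionPoly (f ^ p ^ k)).natDegree := by
    intro k j hj
    induction j with
    | zero => simp
    | succ j ih =>
      have h1 := hdeg _ (hp.not_dvd_choose_mod_add k (Nat.le_of_succ_le hj))
      have h2 := hdeg _ (hp.not_dvd_choose_pow_of_digit_ne_zero k (Nat.ne_zero_of_lt hj))
      rw [mul_add, mul_one, ← add_assoc, pow_add f,
        natDegree_functionPoly_mul (hne _) (hne _) (by omega), ih (Nat.le_of_succ_le hj)]
      ring
  have hmod : ∀ N, (functionPoly (f ^ (m % p ^ N))).natDegree =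
      ∑ k ∈ Finset.range N, (m / p ^ k % p) * (functionPoly (f ^ p ^ k)).natDegree := by
    intro N
    induction N with
    | zero =>
      have h1 : functionPoly (1 : F → F) = 1 :=
        functionPoly_eq (by rw [degree_one]; exact_mod_cast Fintype.card_pos) (by simp)
      simp [Nat.mod_one, h1]
    | succ N ih => rw [Nat.mod_pow_succ, hstep N _ le_rfl, ih, Finset.sum_range_succ]
  have hX : functionPoly (f ^ m) = X ^ m := by
    apply functionPoly_eq
    · rw [degree_X_pow, hF]
      exact_mod_cast (by omega : m < p ^ n)
    · intro x
      simpa [hf0] using (hf x 0).symm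
  rw [← hmod n, Nat.mod_eq_of_lt (by omega), hX, natDegree_X_pow]

/-- A permutation fixing `0` and preserving the `m`-th powers of differences, where `m` is a proper
divisor of `p ^ n - 1`, is a multiple of a power of the Frobenius map. -/
theorem exists_eq_mul_pow_of_sub_pow_eq {p n m : ℕ} (hp : p.Prime) [CharP F p]
    (hF : Fintype.card F = p ^ n) (hm0 : 0 < m) (hm : 2 * m < p ^ n) (hdvd : m ∣ p ^ n - 1)
    {f : F → F} (hf0 : f 0 = 0) (hf : ∀ x y, (f x - f y) ^ m = (x - y) ^ m)
    (hinj : Function.Injective f) :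
    ∃ a : F, ∃ s < n, ∀ x, f x = a * x ^ p ^ s := by
  have hsum := sum_digits_mul_natDegree hp hF hm hf0 hf hinj
  obtain ⟨k, hkn, hk⟩ : ∃ k < n, m / p ^ k % p ≠ 0 := by
    by_contra! h
    refine hm0.ne' (hsum.symm.trans (Finset.sum_eq_zero fun k hk => ?_))
    rw [h k (Finset.mem_range.1 hk), zero_mul]
  set P := functionPoly f with hP
  have hlt : ∀ j ∈ P.support, j < p ^ n := fun j hj => hF ▸ lt_card_of_mem_support_functionPoly hj
  have hzero : ∀ j ∈ P.support, j ≠ 0 := by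
    rintro j hj rfl
    rw [mem_support_iff, coeff_zero_eq_eval_zero, hP, functionPoly_eval] at hj
    exact hj hf0
  have hkey : ∀ j ∈ P.support, j = p ^ Nat.log p j ∧
      (functionPoly (f ^ p ^ k)).natDegree = p ^ ((k + Nat.log p j) % n) := by
    intro j hj
    have hrot : ∀ i < n, digitRotate p n i j ≤ (functionPoly (f ^ p ^ i)).natDegree := fun i hi =>
      digitRotate_le_natDegree hp hF hi.le f (mem_support_iff.1 hj)
    have hpow := fun i (hi : i < n) => pow_le_digitRotate hp hi (hzero j hj) (hlt j hj)
    have hle : ∀ i ∈ Finset.range n, (m / p ^ i % p) * p ^ ((i + Nat.log p j) % n) ≤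
        (m / p ^ i % p) * (functionPoly (f ^ p ^ i)).natDegree := fun i hi =>
      Nat.mul_le_mul_left _
        ((hpow i (Finset.mem_range.1 hi)).1.trans (hrot i (Finset.mem_range.1 hi)))
    have heq := (Finset.sum_eq_sum_iff_of_le hle).1 (le_antisymm (Finset.sum_le_sum hle)
      (hsum.le.trans (le_sum_digits_rotate hp hm0 (by omega) hdvd _))) k (Finset.mem_range.2 hkn)
    have hdeg := (Nat.eq_of_mul_eq_mul_left (Nat.pos_of_ne_zero hk) heq).symm
    exact ⟨(hpow k hkn).2 ((hrot k hkn).trans hdeg.le), hdeg⟩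
  have hlog : ∀ j ∈ P.support, Nat.log p j < n := fun j hj =>
    (Nat.pow_lt_pow_iff_right hp.one_lt).1 ((hkey j hj).1 ▸ hlt j hj)
  have hf_ne : f ≠ 0 := fun h => one_ne_zero (hinj ((congrFun h 1).trans (congrFun h 0).symm))
  obtain ⟨j, hj⟩ := nonempty_support_iff.2 (functionPoly_ne_zero hf_ne)
  rw [← hP] at hj
  have huniq : ∀ i ∈ P.support, i = j := by
    intro i hi
    have h1 := Nat.pow_right_injective hp.two_le ((hkey i hi).2.symm.trans (hkey j hj).2)
    have h2 : Nat.log p i ≡ Nat.log p j [MOD n] := Nat.ModEq.add_left_cancel' k h1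
    rw [(hkey i hi).1, (hkey j hj).1, h2.eq_of_lt_of_lt (hlog i hi) (hlog j hj)]
  refine ⟨P.coeff j, Nat.log p j, hlog j hj, fun x => ?_⟩
  rw [← (hkey j hj).1, ← functionPoly_eval f x, ← hP, eval_eq_sum, Polynomial.sum,
    Finset.sum_eq_single_of_mem j hj fun i hi hij => absurd (huniq i hi) hij]

end Interpolation

theorem Subgroup.image_val_mul_inv_mul_inv {F : Type*} [Field F] (K : Subgroup Fˣ) :
    letI S : Set F := ((↑) : Fˣ → F) '' (K : Set Fˣ)
    S * S⁻¹ * S⁻¹ = S := by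
  ext x
  simp only [Set.mem_mul, Set.mem_inv, Set.mem_image, SetLike.mem_coe]
  constructor
  · rintro ⟨_, ⟨_, ⟨a, ha, rfl⟩, b, ⟨b', hb, hb'⟩, rfl⟩, c, ⟨c', hc, hc'⟩, rfl⟩
    refine ⟨a * b'⁻¹ * c'⁻¹, K.mul_mem (K.mul_mem ha (K.inv_mem hb)) (K.inv_mem hc), ?_⟩
    push_cast
    rw [hb', hc', inv_inv, inv_inv]
  · rintro ⟨a, ha, rfl⟩
    exact ⟨a, ⟨a, ⟨a, ha, rfl⟩, 1, ⟨1, K.one_mem, by simp⟩, by simp⟩, 1,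
      ⟨1, K.one_mem, by simp⟩, by simp⟩

theorem stmt_14 {p n : ℕ} (hp : p.Prime) (hn : 0 < n)
    {F : Type*} [Field F] [Fintype F] (hF : Fintype.card F = p ^ n)
    (K : Subgroup Fˣ) (hK : K ≠ ⊤)
    (S : Set F) (hS : S = ((↑) : Fˣ → F) '' (K : Set Fˣ))
    (f : F → F) (hf : ∀ x y : F, x ≠ y → (f x - f y) / (x - y) ∈ S) :
    (S * S⁻¹ * S⁻¹).ncard = S.ncard ∧
      S.ncard ≤ (p ^ n - 1) / 2 ∧ (p ^ n - 1) / 2 ≤ (p ^ n + 1) / 2 ∧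
      ∃ a b : F, ∃ j : ℕ, j ≤ n - 1 ∧ ∀ x : F, f x = a * x ^ (p ^ j) + b := by
  subst hS
  have : CharP F p := by
    obtain ⟨r, hr⟩ := CharP.exists F
    obtain ⟨k, hrp, hk⟩ := FiniteField.card F r
    have hpr : p = r := by
      have h : p ∣ r ^ (k : ℕ) := by
        rw [← hk, hF]
        exact dvd_pow_self p hn.ne'
      exact (Nat.prime_dvd_prime_iff_eq hp hrp).1 (hp.dvd_of_dvd_pow h)
    exact hpr ▸ hr
  have hcard : (((↑) : Fˣ → F) '' (K : Set Fˣ)).ncard = Nat.card K := by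
    rw [Set.ncard_image_of_injective _ Units.val_injective]
    rfl
  have hmul : Nat.card K * K.index = p ^ n - 1 := by
    rw [K.card_mul_index, Nat.card_units, Nat.card_eq_fintype_card, hF]
  have hindex : 2 ≤ K.index := by
    have h0 : K.index ≠ 0 := Subgroup.FiniteIndex.index_ne_zero
    have h1 : K.index ≠ 1 := fun h => hK (Subgroup.index_eq_one.1 h)
    omega
  have hpos : 0 < Nat.card K := Nat.card_pos
  have hle : 2 * Nat.card K ≤ p ^ n - 1 := by
    rw [← hmul, mul_comm]
    exact Nat.mul_le_mul_left _ hindex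
  refine ⟨by rw [K.image_val_mul_inv_mul_inv], by rw [hcard]; omega, by omega, ?_⟩
  have hinj : Function.Injective f := by
    intro x y hxy
    by_contra hne
    obtain ⟨u, -, hu⟩ := hf x y hne
    rw [hxy, sub_self, zero_div] at hu
    exact u.ne_zero hu
  have hpow : ∀ x y, (f x - f y) ^ Nat.card K = (x - y) ^ Nat.card K := by
    intro x y
    rcases eq_or_ne x y with rfl | hne
    · simp
    · obtain ⟨u, hu, hu'⟩ := hf x y hne
      have hone : u ^ Nat.card K = 1 :=
        congrArg Subtype.val (pow_card_eq_one' (x := (⟨u, hu⟩ : K)))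
      rw [← div_mul_cancel₀ (f x - f y) (sub_ne_zero.2 hne), ← hu', mul_pow,
        ← Units.val_pow_eq_pow_val, hone, Units.val_one, one_mul]
  obtain ⟨a, s, hs, ha⟩ := exists_eq_mul_pow_of_sub_pow_eq (f := fun x => f x - f 0) hp hF hpos
    (by omega) (Dvd.intro _ hmul) (sub_self _) (fun x y => by simpa using hpow x y)
    (fun x y h => hinj (sub_left_inj.1 h))
  exact ⟨a, f 0, s, by omega, fun x => by rw [← ha x, sub_add_cancel]⟩
end
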